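/- arXiv:math/0007018 — 2 statements merged into one kernel-verified Lean document; each statement's English description precedes it below -/
import Mathlib

section
/- Two indefinite unimodular integral symmetric bilinear lattices are isomorphic if and only if they have the same rank, the same signature, and the same type (even or odd). -/
/-!
STATEMENT 7: Two indefinite unimodular integral symmetric bilinear lattices are
isomorphic if and only if they have the same rank, the same signature, and the
same type (even or odd).  (Hasse–Minkowski / Serre classification.)

A lattice is realized as ℤ^n with a symmetric Gram matrix of determinant ±1.
-/

open Matrix

/-- The integral bilinear form of a Gram matrix. -/
def intForm {n : ℕ} (M : Matrix (Fin n) (Fin n) ℤ) (x y : Fin n → ℤ) : ℤ :=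
  x ⬝ᵥ M.mulVec y

/-- The induced real bilinear form. -/
def realForm {n : ℕ} (M : Matrix (Fin n) (Fin n) ℤ) (x y : Fin n → ℝ) : ℝ :=
  x ⬝ᵥ ((M.map (Int.cast : ℤ → ℝ)).mulVec y)

/-- The positive index of inertia b₊: the largest dimension of a subspace of
ℝ^n on which the real form is positive definite. -/
noncomputable def posIndex {n : ℕ} (M : Matrix (Fin n) (Fin n) ℤ) : ℕ :=
  sSup {k | ∃ H : Submodule ℝ (Fin n → ℝ), Module.finrank ℝ H = k ∧
    ∀ x ∈ H, x ≠ 0 → 0 < realForm M x x}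

/-- The negative index of inertia b₋. -/
noncomputable def negIndex {n : ℕ} (M : Matrix (Fin n) (Fin n) ℤ) : ℕ :=
  sSup {k | ∃ H : Submodule ℝ (Fin n → ℝ), Module.finrank ℝ H = k ∧
    ∀ x ∈ H, x ≠ 0 → realForm M x x < 0}

/-- The signature σ = b₊ − b₋. -/
noncomputable def signatureZ {n : ℕ} (M : Matrix (Fin n) (Fin n) ℤ) : ℤ :=
  (posIndex M : ℤ) - (negIndex M : ℤ)

/-- The lattice is unimodular. -/
def Unimodular {n : ℕ} (M : Matrix (Fin n) (Fin n) ℤ) : Prop :=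
  M.det = 1 ∨ M.det = -1

/-- The lattice is indefinite. -/
def Indefinite {n : ℕ} (M : Matrix (Fin n) (Fin n) ℤ) : Prop :=
  0 < posIndex M ∧ 0 < negIndex M

/-- The lattice is even: all vectors have even square. -/
def IsEvenLattice {n : ℕ} (M : Matrix (Fin n) (Fin n) ℤ) : Prop :=
  ∀ x : Fin n → ℤ, 2 ∣ intForm M x x

/-- Isomorphism (isometry) of integral lattices: a ℤ-linear equivalence
preserving the bilinear forms. -/
def LatticeIso {n n' : ℕ} (M : Matrix (Fin n) (Fin n) ℤ)
    (M' : Matrix (Fin n') (Fin n') ℤ) : Prop :=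
  ∃ e : (Fin n → ℤ) ≃ₗ[ℤ] (Fin n' → ℤ), ∀ x y, intForm M' (e x) (e y) = intForm M x y

namespace IUL
open Matrix Module

/-- isotropic subspaces of nondegenerate spaces have at most half the dimension -/
lemma iso_bound {K ι : Type} [Field K] [Fintype ι] [DecidableEq ι] (N : Matrix ι ι K)
    (hN : N.det ≠ 0) (U : Submodule K (ι → K))
    (hU : ∀ x ∈ U, ∀ y ∈ U, x ⬝ᵥ N *ᵥ y = 0) : 2 * finrank K U ≤ Fintype.card ι := by
  have hnd := LinearMap.BilinForm.nondegenerate_toBilin'_iff_det_ne_zero.mpr hN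
  have h1 := LinearMap.BilinForm.finrank_orthogonal hnd U
  have h2 : U ≤ (Matrix.toBilin' N).orthogonal U := by
    intro x hx
    rw [LinearMap.BilinForm.mem_orthogonal_iff]
    intro y hy
    rw [Matrix.toBilin'_apply']
    exact hU y hy x hx
  have h3 := Submodule.finrank_mono h2
  have h4 := Submodule.finrank_le U
  rw [finrank_fintype_fun_eq_card] at *
  omega

/-- metabolic forms -/
def Met {ι : Type} [Fintype ι] (N : Matrix ι ι ℚ) : Prop :=
  ∃ U : Submodule ℚ (ι → ℚ), (∀ x ∈ U, ∀ y ∈ U, x ⬝ᵥ N *ᵥ y = 0) ∧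
    Fintype.card ι = 2 * finrank ℚ U

lemma finrank_map_add {V W : Type} [AddCommGroup V] [Module ℚ V] [AddCommGroup W] [Module ℚ W]
    [FiniteDimensional ℚ V] (f : V →ₗ[ℚ] W) (T K : Submodule ℚ V)
    (h : ∀ x ∈ T, f x = 0 → x ∈ K) :
    finrank ℚ T ≤ finrank ℚ (T.map f) + finrank ℚ (T ⊓ K : Submodule ℚ V) := by
  have h1 := LinearMap.finrank_range_add_finrank_ker (f.domRestrict T)
  have h2 : LinearMap.range (f.domRestrict T) = T.map f := by
    ext x; simp
  rw [h2] at h1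
  have h3 : finrank ℚ (LinearMap.ker (f.domRestrict T)) ≤ finrank ℚ (T ⊓ K : Submodule ℚ V) := by
    rw [← Submodule.finrank_map_subtype_eq]
    apply Submodule.finrank_mono
    rintro x ⟨y, hy, rfl⟩
    exact ⟨y.2, h y.1 y.2 (by simpa using hy)⟩
  omega

lemma met_cancel {ι κ : Type} [Fintype ι] [Fintype κ] [DecidableEq ι] [DecidableEq κ]
    (M : Matrix ι ι ℚ) (N : Matrix κ κ ℚ) (hM : M.det ≠ 0) (hN : N.det ≠ 0)
    (h : Met (fromBlocks M 0 0 N)) (h' : Met N) : Met M := by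
  obtain ⟨U, hU, hUd⟩ := h
  obtain ⟨K, hK, hKd⟩ := h'
  set D := fromBlocks M 0 0 N with hD
  have hdet : D.det ≠ 0 := by
    rw [hD, Matrix.det_fromBlocks_zero₂₁]; exact mul_ne_zero hM hN
  have hnd := LinearMap.BilinForm.nondegenerate_toBilin'_iff_det_ne_zero.mpr hdet
  have hndN := LinearMap.BilinForm.nondegenerate_toBilin'_iff_det_ne_zero.mpr hN
  have hDapp : ∀ x y : ι ⊕ κ → ℚ, x ⬝ᵥ D *ᵥ y =
      (x ∘ Sum.inl) ⬝ᵥ M *ᵥ (y ∘ Sum.inl) + (x ∘ Sum.inr) ⬝ᵥ N *ᵥ (y ∘ Sum.inr) := by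
    intro x y
    rw [hD, Matrix.fromBlocks_mulVec]
    simp [dotProduct, Fintype.sum_sum_type]
  -- K is its own orthogonal
  have hKo : (Matrix.toBilin' N).orthogonal K = K := by
    symm
    apply Submodule.eq_of_le_of_finrank_eq
    · intro x hx
      rw [LinearMap.BilinForm.mem_orthogonal_iff]
      intro y hy
      rw [Matrix.toBilin'_apply']
      exact hK y hy x hx
    · rw [LinearMap.BilinForm.finrank_orthogonal hndN, finrank_fintype_fun_eq_card]
      omega
  have hUo : (Matrix.toBilin' D).orthogonal U = U := by
    symm
    apply Submodule.eq_of_le_of_finrank_eq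
    · intro x hx
      rw [LinearMap.BilinForm.mem_orthogonal_iff]
      intro y hy
      rw [Matrix.toBilin'_apply']
      exact hU y hy x hx
    · rw [LinearMap.BilinForm.finrank_orthogonal hnd, finrank_fintype_fun_eq_card]
      omega
  let inr : (κ → ℚ) →ₗ[ℚ] (ι ⊕ κ → ℚ) :=
    { toFun := fun x => Sum.elim 0 x
      map_add' := by intro x y; ext (i | i) <;> simp
      map_smul' := by intro x y; ext (i | i) <;> simp }
  have hinr : Function.Injective inr := by
    intro x y hxy
    ext i
    exact congrFun hxy (Sum.inr i)
  set K' := K.map inr with hK'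
  have hK'd : finrank ℚ K' = finrank ℚ K := (Submodule.equivMapOfInjective inr hinr K).finrank_eq.symm
  let π : (ι ⊕ κ → ℚ) →ₗ[ℚ] (ι → ℚ) := LinearMap.funLeft ℚ ℚ Sum.inl
  set T := (Matrix.toBilin' D).orthogonal (U ⊔ K') with hT
  have hTU : ∀ x ∈ T, x ∈ U := by
    intro x hx
    rw [← hUo]
    exact LinearMap.BilinForm.orthogonal_le le_sup_left hx
  have hTK : ∀ x ∈ T, x ∘ Sum.inr ∈ K := by
    intro x hx
    have hx := LinearMap.BilinForm.orthogonal_le (le_sup_right : K' ≤ U ⊔ K') hx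
    rw [← hKo, LinearMap.BilinForm.mem_orthogonal_iff]
    rw [LinearMap.BilinForm.mem_orthogonal_iff] at hx
    intro y hy
    have := hx _ (Submodule.mem_map_of_mem hy)
    rw [Matrix.toBilin'_apply', hDapp] at this
    rw [Matrix.toBilin'_apply']
    have e1 : (inr y) ∘ Sum.inl = 0 := rfl
    have e2 : (inr y) ∘ Sum.inr = y := rfl
    rw [e1, e2] at this
    simpa using this
  have h1 := finrank_map_add π T K' (by
    intro x hx h0
    refine ⟨x ∘ Sum.inr, hTK x hx, ?_⟩
    ext (i | i)
    · exact (congrFun h0 i).symm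
    · rfl)
  have h2 : finrank ℚ (T ⊓ K' : Submodule ℚ _) ≤ finrank ℚ (U ⊓ K' : Submodule ℚ _) :=
    Submodule.finrank_mono (inf_le_inf_right _ hTU)
  have h3 := Submodule.finrank_sup_add_finrank_inf_eq U K'
  have h4 : finrank ℚ T = _ := LinearMap.BilinForm.finrank_orthogonal hnd (U ⊔ K')
  rw [finrank_fintype_fun_eq_card] at h4
  have hiso : ∀ x ∈ T.map π, ∀ y ∈ T.map π, x ⬝ᵥ M *ᵥ y = 0 := by
    rintro _ ⟨x, hx, rfl⟩ _ ⟨y, hy, rfl⟩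
    have := hU x (hTU x hx) y (hTU y hy)
    rw [hDapp, hK _ (hTK x hx) _ (hTK y hy), add_zero] at this
    exact this
  refine ⟨T.map π, hiso, ?_⟩
  have h5 := iso_bound M hM _ hiso
  rw [Fintype.card_sum] at *
  have h6 := Submodule.finrank_le (U ⊔ K')
  rw [finrank_fintype_fun_eq_card, Fintype.card_sum] at h6
  omega

lemma met_equiv {ι κ : Type} [Fintype ι] [Fintype κ]
    (M : Matrix ι ι ℚ) (N : Matrix κ κ ℚ) (e : (ι → ℚ) ≃ₗ[ℚ] (κ → ℚ))
    (he : ∀ x y, e x ⬝ᵥ N *ᵥ e y = x ⬝ᵥ M *ᵥ y) (h : Met M) : Met N := by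
  obtain ⟨U, hU, hUd⟩ := h
  refine ⟨U.map (e : (ι → ℚ) →ₗ[ℚ] (κ → ℚ)), ?_, ?_⟩
  · rintro _ ⟨x, hx, rfl⟩ _ ⟨y, hy, rfl⟩
    exact (he x y).trans (hU x hx y hy)
  · rw [LinearEquiv.finrank_map_eq, ← hUd]
    have := e.finrank_eq
    simpa using this.symm

end IUL

namespace IUL
open Matrix Module

/-- diagonal rational matrix -/
def dg {ι : Type} [DecidableEq ι] (a : ι → ℤ) : Matrix ι ι ℚ := diagonal (fun i => (a i : ℚ))

lemma dg_app {ι : Type} [DecidableEq ι] [Fintype ι] (a : ι → ℤ) (x y : ι → ℚ) :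
    x ⬝ᵥ dg a *ᵥ y = ∑ i, (a i : ℚ) * x i * y i := by
  simp only [dg, dotProduct, mulVec_diagonal]
  exact Finset.sum_congr rfl (fun i _ => by ring)

lemma dg_det {ι : Type} [DecidableEq ι] [Fintype ι] (a : ι → ℤ) (ha : ∀ i, a i ≠ 0) :
    (dg a).det ≠ 0 := by
  rw [dg, det_diagonal]
  exact Finset.prod_ne_zero_iff.mpr (fun i _ => by exact_mod_cast ha i)

lemma dg_sum {ι κ : Type} [DecidableEq ι] [Fintype ι] [DecidableEq κ] [Fintype κ]
    (a : ι → ℤ) (b : κ → ℤ) : fromBlocks (dg a) 0 0 (dg b) = dg (Sum.elim a b) := by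
  rw [dg, dg, fromBlocks_diagonal, dg]
  congr 1
  ext (i | i) <;> rfl

lemma met_reindex {ι κ : Type} [DecidableEq ι] [Fintype ι] [DecidableEq κ] [Fintype κ]
    (a : ι → ℤ) (b : κ → ℤ) (e : ι ≃ κ) (h : ∀ i, a i = b (e i)) (hm : Met (dg a)) :
    Met (dg b) := by
  refine met_equiv (dg a) (dg b) (LinearEquiv.funCongrLeft ℚ ℚ e.symm) ?_ hm
  intro x y
  rw [dg_app, dg_app, ← e.sum_comp]
  simp [h]

/-- multiset version -/
def MMet (s : Multiset ℤ) : Prop :=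
  ∃ (ι : Type) (_ : Fintype ι) (_ : DecidableEq ι) (a : ι → ℤ),
    Finset.univ.val.map a = s ∧ Met (dg a)

lemma fam_exists {A : Type} (s : Multiset A) : ∃ (n : ℕ) (a : Fin n → A), Finset.univ.val.map a = s := by
  induction s using Quotient.inductionOn with
  | h l =>
    refine ⟨l.length, l.get, ?_⟩
    simp [Fin.univ_val_map]

lemma fam_equiv {ι κ : Type} [Fintype ι] [Fintype κ] (a : ι → ℤ) (b : κ → ℤ)
    (h : Finset.univ.val.map a = Finset.univ.val.map b) : ∃ e : ι ≃ κ, ∀ i, a i = b (e i) := by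
  classical
  have hc : ∀ v, Nonempty ({i // a i = v} ≃ {j // b j = v}) := by
    intro v
    apply Fintype.card_eq.mp
    have := congrArg (Multiset.count v) h
    rw [Multiset.count_map, Multiset.count_map] at this
    rw [Fintype.card_subtype, Fintype.card_subtype, Finset.card_def, Finset.card_def]
    simp only [Finset.filter_val]
    simpa only [eq_comm] using this
  let f := fun v => (hc v).some
  refine ⟨(Equiv.sigmaFiberEquiv a).symm.trans ((Equiv.sigmaCongrRight f).trans
    (Equiv.sigmaFiberEquiv b)), ?_⟩
  intro i
  exact ((f (a i)) ⟨i, rfl⟩).2.symm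

lemma MMet.fam {ι : Type} [Fintype ι] [DecidableEq ι] (a : ι → ℤ)
    (h : MMet (Finset.univ.val.map a)) : Met (dg a) := by
  obtain ⟨κ, _, _, b, hb, hm⟩ := h
  obtain ⟨e, he⟩ := fam_equiv b a hb
  exact met_reindex b a e he hm

lemma sum_fam {ι κ : Type} [Fintype ι] [Fintype κ] (a : ι → ℤ) (b : κ → ℤ) :
    Finset.univ.val.map (Sum.elim a b) = Finset.univ.val.map a + Finset.univ.val.map b := by
  have : (Finset.univ : Finset (ι ⊕ κ)).val = Multiset.disjSum Finset.univ.val Finset.univ.val := rfl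
  rw [this, Multiset.disjSum, Multiset.map_add, Multiset.map_map, Multiset.map_map]
  rfl

lemma MMet.cancel (s t : Multiset ℤ) (hs : ∀ x ∈ s, x ≠ 0) (ht : ∀ x ∈ t, x ≠ 0)
    (h : MMet (s + t)) (h' : MMet t) : MMet s := by
  obtain ⟨n, a, rfl⟩ := fam_exists s
  obtain ⟨m, b, rfl⟩ := fam_exists t
  rw [← sum_fam] at h
  have h := h.fam
  have h' := h'.fam
  rw [← dg_sum] at h
  refine ⟨_, _, inferInstance, a, rfl, met_cancel _ _ (dg_det a ?_) (dg_det b ?_) h h'⟩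
  · intro i; exact hs _ (Multiset.mem_map_of_mem _ (Finset.mem_univ_val i))
  · intro i; exact ht _ (Multiset.mem_map_of_mem _ (Finset.mem_univ_val i))

lemma MMet.self (s : Multiset ℤ) : MMet (s + s.map Neg.neg) := by
  obtain ⟨n, a, rfl⟩ := fam_exists s
  rw [Multiset.map_map, ← sum_fam]
  refine ⟨_, _, inferInstance, _, rfl, ?_⟩
  let f : (Fin n → ℚ) →ₗ[ℚ] (Fin n ⊕ Fin n → ℚ) := LinearMap.funLeft ℚ ℚ (Sum.elim id id)
  refine ⟨LinearMap.range f, ?_, ?_⟩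
  · rintro _ ⟨x, rfl⟩ _ ⟨y, rfl⟩
    rw [dg_app]
    simp [f, LinearMap.funLeft_apply]
  · rw [LinearMap.finrank_range_of_inj]
    · simp; ring
    · intro x y hxy
      ext i
      exact congrFun hxy (Sum.inl i)

/-- generator -/
noncomputable def gen (a : ℤ) : ℤ →₀ ℤ := Finsupp.single a 1

/-- formal sum of a multiset -/
noncomputable def ms (s : Multiset ℤ) : ℤ →₀ ℤ := (s.map gen).sum

lemma ms_add (s t : Multiset ℤ) : ms (s + t) = ms s + ms t := by simp [ms]

lemma ms_count (s : Multiset ℤ) (v : ℤ) : ms s v = s.count v := by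
  induction s using Multiset.induction_on with
  | empty => simp [ms]
  | cons a s ih =>
    have : ms (a ::ₘ s) = gen a + ms s := by simp [ms]
    rw [this, Finsupp.add_apply, ih, Multiset.count_cons, gen, Finsupp.single_apply]
    by_cases h : v = a
    · subst h; simp; ring
    · rw [if_neg h, if_neg (Ne.symm h)]; simp

lemma ms_inj {s t : Multiset ℤ} (h : ms s = ms t) : s = t := by
  ext v
  have := congrArg (fun f => f v) h
  simp only [ms_count] at this
  exact_mod_cast this

/-- defining relations of the Witt group -/
def Rel : Set (ℤ →₀ ℤ) :=
  {z | ∃ s t : Multiset ℤ, (∀ x ∈ s, x ≠ 0) ∧ (∀ x ∈ t, x ≠ 0) ∧ z = ms s - ms t ∧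
    MMet (s + t.map Neg.neg)}

/-- The Witt group -/
def WG : Type := (ℤ →₀ ℤ) ⧸ AddSubgroup.closure Rel

noncomputable instance : AddCommGroup WG :=
  inferInstanceAs (AddCommGroup ((ℤ →₀ ℤ) ⧸ AddSubgroup.closure Rel))

/-- projection -/
noncomputable def wmk : (ℤ →₀ ℤ) →+ WG := QuotientAddGroup.mk' (AddSubgroup.closure Rel)

lemma wmk_zero (z : ℤ →₀ ℤ) : wmk z = 0 ↔ z ∈ AddSubgroup.closure Rel :=
  QuotientAddGroup.eq_zero_iff z

lemma MMet.neg {s : Multiset ℤ} (h : MMet s) : MMet (s.map Neg.neg) := by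
  obtain ⟨ι, _, _, a, rfl, U, hU, hd⟩ := h
  refine ⟨ι, _, inferInstance, fun i => - a i, by rw [Multiset.map_map]; rfl, U, ?_, hd⟩
  intro x hx y hy
  have := hU x hx y hy
  rw [dg_app] at *
  simp only [Int.cast_neg, neg_mul, Finset.sum_neg_distrib, this, neg_zero]

lemma closure_met {z : ℤ →₀ ℤ} (hz : z ∈ AddSubgroup.closure Rel) :
    ∀ s t : Multiset ℤ, (∀ x ∈ s, x ≠ 0) → (∀ x ∈ t, x ≠ 0) → z = ms s - ms t →
      MMet (s + t.map Neg.neg) := by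
  have key : ∀ s t s' t' : Multiset ℤ, (∀ x ∈ s, x ≠ 0) → (∀ x ∈ t, x ≠ 0) →
      (∀ x ∈ s', x ≠ 0) → (∀ x ∈ t', x ≠ 0) →
      MMet ((s + t') + (t + s').map Neg.neg) → MMet (s' + t'.map Neg.neg) →
      MMet (s + t.map Neg.neg) := by
    intro s t s' t' hs ht hs' ht' h1 h2
    have e : MMet (t' + s'.map Neg.neg) := by
      have := h2.neg
      rw [Multiset.map_add, Multiset.map_map, add_comm] at this
      simpa using this
    refine MMet.cancel _ (t' + s'.map Neg.neg) ?_ ?_ ?_ e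
    · intro x hx
      rw [Multiset.mem_add, Multiset.mem_map] at hx
      rcases hx with hx | ⟨y, hy, rfl⟩
      · exact hs x hx
      · exact neg_ne_zero.mpr (ht y hy)
    · intro x hx
      rw [Multiset.mem_add, Multiset.mem_map] at hx
      rcases hx with hx | ⟨y, hy, rfl⟩
      · exact ht' x hx
      · exact neg_ne_zero.mpr (hs' y hy)
    · rw [Multiset.map_add] at h1
      convert h1 using 1
      abel
  have nz : ∀ {s t : Multiset ℤ}, (∀ x ∈ s, x ≠ 0) → (∀ x ∈ t, x ≠ 0) → ∀ x ∈ s + t, x ≠ 0 := by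
    intro s t hs ht x hx
    rcases Multiset.mem_add.mp hx with hx | hx
    · exact hs x hx
    · exact ht x hx
  induction hz using AddSubgroup.closure_induction_left with
  | zero =>
    intro s t hs ht h
    have : s = t := ms_inj (sub_eq_zero.mp h.symm)
    subst this
    exact MMet.self s
  | add_left x hx y hy ih =>
    intro s t hs ht h
    obtain ⟨s', t', hs', ht', rfl, hm⟩ := hx
    refine key s t s' t' hs ht hs' ht' (ih _ _ (nz hs ht') (nz ht hs') ?_) hm
    have e : y = (ms s - ms t) - (ms s' - ms t') := by rw [← h]; abel
    rw [ms_add, ms_add, e]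
    abel
  | neg_add_cancel x hx y hy ih =>
    intro s t hs ht h
    obtain ⟨s', t', hs', ht', rfl, hm⟩ := hx
    refine key s t t' s' hs ht ht' hs' (ih _ _ (nz hs hs') (nz ht ht') ?_) ?_
    · have e : y = (ms s - ms t) + (ms s' - ms t') := by rw [← h]; abel
      rw [ms_add, ms_add, e]
      abel
    · have := hm.neg
      rw [Multiset.map_add, Multiset.map_map, add_comm] at this
      simpa using this

/-- class of a one dimensional form -/
noncomputable def cls (a : ℤ) : WG := wmk (gen a)

lemma met_of_sum_zero {ι : Type} [Fintype ι] [DecidableEq ι] (a : ι → ℤ) (ha : ∀ i, a i ≠ 0)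
    (h : ∑ i, cls (a i) = 0) : Met (dg a) := by
  apply MMet.fam
  have h2 : wmk (ms (Finset.univ.val.map a)) = 0 := by
    rw [← h, ms, Multiset.map_map]
    exact map_sum wmk (fun i => gen (a i)) Finset.univ
  have := closure_met ((wmk_zero _).mp h2) (Finset.univ.val.map a) 0
    (by intro x hx; obtain ⟨i, _, rfl⟩ := Multiset.mem_map.mp hx; exact ha i)
    (by simp) (by simp [ms])
  simpa using this

lemma cls_rel (s t : Multiset ℤ) (hs : ∀ x ∈ s, x ≠ 0) (ht : ∀ x ∈ t, x ≠ 0)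
    (h : MMet (s + t.map Neg.neg)) : (s.map cls).sum = (t.map cls).sum := by
  have e : ∀ s : Multiset ℤ, (s.map cls).sum = wmk (ms s) := by
    intro s
    have := map_multiset_sum wmk (s.map gen)
    rw [Multiset.map_map] at this
    exact this.symm
  rw [e, e, ← sub_eq_zero, ← map_sub]
  exact (wmk_zero _).mpr
    (AddSubgroup.subset_closure ⟨s, t, hs, ht, rfl, h⟩)

lemma cls_neg (a : ℤ) (ha : a ≠ 0) : cls (-a) = - cls a := by
  have := cls_rel (({a} : Multiset ℤ) + {-a}) 0 (by simp [ha]) (by simp)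
    (by simpa using MMet.self {a})
  rw [eq_neg_iff_add_eq_zero, add_comm]
  simpa using this

lemma cls_sq (a c : ℤ) (ha : a ≠ 0) (hc : c ≠ 0) : cls (a * c ^ 2) = cls a := by
  have := cls_rel ({a * c ^ 2} : Multiset ℤ) {a} (by simp [ha, hc]) (by simp [ha]) (by
    refine ⟨Fin 2, inferInstance, inferInstance, ![a * c ^ 2, -a], by
      simp [Fin.univ_val_map]; rfl, ?_⟩
    refine ⟨Submodule.span ℚ {![1, (c : ℚ)]}, ?_, ?_⟩
    · intro x hx y hy
      obtain ⟨r, rfl⟩ := Submodule.mem_span_singleton.mp hx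
      obtain ⟨s, rfl⟩ := Submodule.mem_span_singleton.mp hy
      rw [dg_app]
      simp [Fin.sum_univ_two]
      ring
    · rw [finrank_span_singleton]
      · simp
      · intro h; simpa using congrFun h 0)
  simpa using this

lemma cls_add (a b : ℤ) (ha : a ≠ 0) (hb : b ≠ 0) (hab : a + b ≠ 0) :
    cls a + cls b = cls (a + b) + cls (a * b * (a + b)) := by
  have := cls_rel (({a} : Multiset ℤ) + {b}) ({a + b} + {a * b * (a + b)})
    (by simp [ha, hb]) (by simp [ha, hb, hab]) (by
    refine ⟨Fin 4, inferInstance, inferInstance, ![a, b, -(a+b), -(a * b * (a + b))], by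
      rw [Fin.univ_val_map]; rfl, ?_⟩
    let f : (Fin 2 → ℚ) →ₗ[ℚ] (Fin 4 → ℚ) :=
      { toFun := fun x => ![x 0 + b * x 1, x 0 - a * x 1, x 0, x 1]
        map_add' := by intro x y; ext i; fin_cases i <;> simp <;> ring
        map_smul' := by intro x y; ext i; fin_cases i <;> simp <;> ring }
    refine ⟨LinearMap.range f, ?_, ?_⟩
    · rintro _ ⟨x, rfl⟩ _ ⟨y, rfl⟩
      rw [dg_app]
      simp [Fin.sum_univ_four, f]
      ring
    · rw [LinearMap.finrank_range_of_inj]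
      · simp
      · intro x y hxy
        ext i
        fin_cases i
        · exact congrFun hxy 2
        · exact congrFun hxy 3)
  simpa using this

end IUL

namespace IUL
open Matrix Module

/-- smooth integers -/
def Sm (P : ℕ) (u : ℤ) : Prop := u ≠ 0 ∧ ∀ q : ℕ, q.Prime → (q : ℤ) ∣ u → q < P

lemma Sm.mul {P : ℕ} {u v : ℤ} (hu : Sm P u) (hv : Sm P v) : Sm P (u * v) := by
  refine ⟨mul_ne_zero hu.1 hv.1, fun q hq h => ?_⟩
  rcases (Nat.prime_iff_prime_int.mp hq).dvd_or_dvd h with h | h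
  · exact hu.2 q hq h
  · exact hv.2 q hq h

lemma Sm.neg {P : ℕ} {u : ℤ} (hu : Sm P u) : Sm P (-u) :=
  ⟨neg_ne_zero.mpr hu.1, fun q hq h => hu.2 q hq ((dvd_neg).mp h)⟩

lemma Sm.small {P : ℕ} {u : ℤ} (h0 : u ≠ 0) (h : |u| < P) : Sm P u := by
  refine ⟨h0, fun q hq hd => ?_⟩
  have := Int.le_of_dvd (abs_pos.mpr h0) ((dvd_abs _ _).mpr hd)
  exact_mod_cast this.trans_lt h

lemma Sm.not_dvd {P : ℕ} (hP : P.Prime) {u : ℤ} (hu : Sm P u) : ¬ (P : ℤ) ∣ u :=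
  fun h => lt_irrefl _ (hu.2 P hP h)

/-- filtration of the Witt group -/
noncomputable def FL (P : ℕ) : AddSubgroup WG := AddSubgroup.closure {x | ∃ s, Sm P s ∧ x = cls s}

lemma FL_mem {P : ℕ} {s : ℤ} (h : Sm P s) : cls s ∈ FL P := AddSubgroup.subset_closure ⟨s, h, rfl⟩

lemma FL_fam {P : ℕ} {x : WG} (hx : x ∈ FL P) :
    ∃ t : Multiset ℤ, (∀ s ∈ t, Sm P s) ∧ x = (t.map cls).sum := by
  induction hx using AddSubgroup.closure_induction with
  | mem x hx =>
    obtain ⟨s, hs, rfl⟩ := hx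
    exact ⟨{s}, by simpa using hs, by simp⟩
  | zero => exact ⟨0, by simp, by simp⟩
  | add x y _ _ h1 h2 =>
    obtain ⟨t, ht, rfl⟩ := h1
    obtain ⟨t', ht', rfl⟩ := h2
    refine ⟨t + t', ?_, by simp⟩
    intro s hs
    rcases Multiset.mem_add.mp hs with h | h
    · exact ht s h
    · exact ht' s h
  | neg x _ h1 =>
    obtain ⟨t, ht, rfl⟩ := h1
    refine ⟨t.map Neg.neg, ?_, ?_⟩
    · intro s hs
      obtain ⟨r, hr, rfl⟩ := Multiset.mem_map.mp hs
      exact (ht r hr).neg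
    · rw [Multiset.map_map, ← Multiset.sum_map_neg']
      rw [Multiset.map_map]
      congr 1
      apply Multiset.map_congr rfl
      intro s hs
      exact (cls_neg s (ht s hs).1).symm

/-- quotient by the filtration -/
def QG (P : ℕ) : Type := WG ⧸ FL P

noncomputable instance (P : ℕ) : AddCommGroup (QG P) :=
  inferInstanceAs (AddCommGroup (WG ⧸ FL P))

/-- projection -/
noncomputable def qmk (P : ℕ) : WG →+ QG P := QuotientAddGroup.mk' (FL P)

lemma qmk_zero {P : ℕ} (z : WG) : qmk P z = 0 ↔ z ∈ FL P :=
  QuotientAddGroup.eq_zero_iff z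

/-- class mod filtration of P u -/
noncomputable def fp (P : ℕ) (u : ℤ) : QG P := qmk P (cls (P * u))

lemma mk_zero {P : ℕ} {s : ℤ} (h : Sm P s) : qmk P (cls s) = 0 :=
  (qmk_zero _).mpr (FL_mem h)

lemma fp_step {P : ℕ} (hP : P.Prime) {u u' q : ℤ} (hu : Sm P u) (hu' : Sm P u') (hq : Sm P q)
    (h : u = u' + P * q) : fp P u = fp P u' := by
  have hP0 : (P : ℤ) ≠ 0 := by exact_mod_cast hP.ne_zero
  have e : (P : ℤ) * u' + q * P ^ 2 = P * u := by rw [h]; ring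
  have h1 := cls_add (P * u') (q * P ^ 2) (mul_ne_zero hP0 hu'.1)
    (mul_ne_zero hq.1 (pow_ne_zero _ hP0)) (by rw [e]; exact mul_ne_zero hP0 hu.1)
  rw [e, cls_sq q P hq.1 hP0] at h1
  have e2 : (P : ℤ) * u' * (q * P ^ 2) * (P * u) = (u' * q * u) * (P ^ 2) ^ 2 := by ring
  rw [e2, cls_sq _ _ ((hu'.mul hq).mul hu).1 (pow_ne_zero _ hP0)] at h1
  have h2 := congrArg (fun x : WG => qmk P x) h1
  simp only [map_add, mk_zero hq, mk_zero ((hu'.mul hq).mul hu), add_zero] at h2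
  exact h2.symm

lemma mod_small {P : ℕ} (hP : P.Prime) {u : ℤ} (hu : ¬ (P : ℤ) ∣ u) :
    0 < u % P ∧ u % P < P := by
  have hP0 : (0 : ℤ) < P := by exact_mod_cast hP.pos
  refine ⟨lt_of_le_of_ne (Int.emod_nonneg _ hP0.ne') ?_, Int.emod_lt_of_pos _ hP0⟩
  intro h
  exact hu (Int.dvd_of_emod_eq_zero h.symm)

lemma fp_basic {P : ℕ} (hP : P.Prime) {a b w : ℤ} (ha : a ≠ 0) (ha' : |a| < P)
    (hb : b ≠ 0) (hb' : |b| < P) (hw : Sm P w) : fp P (a * b * w) = fp P ((a * b) % P * w) := by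
  have hP0 : (0 : ℤ) < P := by exact_mod_cast hP.pos
  have hsa := Sm.small ha ha'
  have hsb := Sm.small hb hb'
  have hm := mod_small hP ((hsa.mul hsb).not_dvd hP)
  have hd := Int.mul_ediv_add_emod (a * b) P
  set r := (a * b) % P
  set q := (a * b) / P
  have hr : Sm P r := Sm.small hm.1.ne' (by rw [abs_of_pos hm.1]; exact hm.2)
  by_cases hq : q = 0
  · rw [hq] at hd
    have : a * b = r := by linarith
    rw [this]
  · have hq' : |q| < P := by
      have h1 : |a * b| ≤ (P - 1) * (P - 1) := by
        rw [abs_mul]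
        have := abs_nonneg a
        have := abs_nonneg b
        have : |a| ≤ P - 1 := by linarith
        have : |b| ≤ P - 1 := by linarith
        apply mul_le_mul <;> linarith
      rw [abs_le] at h1
      rw [abs_lt]
      constructor <;> nlinarith
    exact fp_step hP ((hsa.mul hsb).mul hw) (hr.mul hw) ((Sm.small hq hq').mul hw)
      (by rw [← hd]; ring)

lemma fp_mod {P : ℕ} (hP : P.Prime) (n : ℕ) : ∀ u : ℤ, u.natAbs = n → Sm P u → ∀ w, Sm P w →
    fp P (u * w) = fp P (u % P * w) := by
  have hP0 : (0 : ℤ) < P := by exact_mod_cast hP.pos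
  have hP2 : (2 : ℤ) ≤ P := by exact_mod_cast hP.two_le
  induction n using Nat.strong_induction_on with
  | _ n ih =>
    intro u hn hu w hw
    by_cases h1 : n = 1
    · subst h1
      have := fp_basic hP (a := u) (b := 1) (w := w) hu.1
        (by rw [Int.abs_eq_natAbs, hn]; push_cast; linarith) one_ne_zero
        (by rw [abs_one]; linarith) hw
      simpa using this
    · have hp := Nat.minFac_prime h1
      have hdv : ((n.minFac : ℕ) : ℤ) ∣ u := by
        rw [Int.natCast_dvd, hn]; exact Nat.minFac_dvd n
      obtain ⟨v, rfl⟩ := hdv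
      set p := n.minFac with hpdef
      have hpP : p < P := hu.2 p hp (dvd_mul_right _ _)
      have hp0 : (p : ℤ) ≠ 0 := by exact_mod_cast hp.ne_zero
      have hv0 : v ≠ 0 := by rintro rfl; exact hu.1 (by simp)
      have hv : Sm P v := ⟨hv0, fun q hq hd => hu.2 q hq (hd.mul_left _)⟩
      have hps : Sm P (p : ℤ) := Sm.small hp0 (by simpa using hpP)
      have hlt : v.natAbs < n := by
        rw [← hn, Int.natAbs_mul, Int.natAbs_natCast]
        have := hp.two_le
        have : 0 < v.natAbs := Int.natAbs_pos.mpr hv0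
        nlinarith
      have e1 := ih v.natAbs hlt v rfl hv (p * w) (hps.mul hw)
      have hm := mod_small hP (hv.not_dvd hP)
      have e2 := fp_basic hP (a := p) (b := v % P) (w := w) hp0 (by simpa using hpP) hm.1.ne'
        (by rw [abs_of_pos hm.1]; exact hm.2) hw
      rw [show (p : ℤ) * v * w = v * (p * w) by ring, e1,
        show v % P * (p * w) = p * (v % P) * w by ring, e2]
      simp [Int.mul_emod]

/-- induced function on residues -/
noncomputable def fz (P : ℕ) (r : ZMod P) : QG P := fp P r.val

lemma one_Sm {P : ℕ} (hP : P.Prime) : Sm P 1 := Sm.small one_ne_zero (by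
  rw [abs_one]; exact_mod_cast hP.one_lt)

lemma fz_cast {P : ℕ} (hP : P.Prime) {u : ℤ} (hu : Sm P u) : fz P (u : ZMod P) = fp P u := by
  have : NeZero P := ⟨hP.ne_zero⟩
  have := fp_mod hP _ u rfl hu 1 (one_Sm hP)
  rw [mul_one, mul_one] at this
  rw [this, fz, ZMod.val_intCast]

lemma val_Sm {P : ℕ} (hP : P.Prime) {r : ZMod P} (hr : r ≠ 0) : Sm P (r.val : ℤ) := by
  have : NeZero P := ⟨hP.ne_zero⟩
  apply Sm.small
  · have := (ZMod.val_ne_zero r).mpr hr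
    exact_mod_cast this
  · have := ZMod.val_lt r
    rw [Nat.abs_cast]
    exact_mod_cast this

lemma val_cast {P : ℕ} (hP : P.Prime) (r : ZMod P) : ((r.val : ℤ) : ZMod P) = r := by
  have : NeZero P := ⟨hP.ne_zero⟩
  simp

lemma fz_neg {P : ℕ} (hP : P.Prime) {r : ZMod P} (hr : r ≠ 0) : fz P (-r) = - fz P r := by
  have h := fz_cast hP (val_Sm hP hr).neg
  have hP0 : (P : ℤ) ≠ 0 := by exact_mod_cast hP.ne_zero
  rw [Int.cast_neg, val_cast hP] at h
  rw [h, fp, mul_neg, cls_neg _ (mul_ne_zero hP0 (val_Sm hP hr).1), map_neg]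
  rfl

lemma fz_sq {P : ℕ} (hP : P.Prime) {r c : ZMod P} (hr : r ≠ 0) (hc : c ≠ 0) :
    fz P (r * c ^ 2) = fz P r := by
  have hP0 : (P : ℤ) ≠ 0 := by exact_mod_cast hP.ne_zero
  have hcs := val_Sm hP hc
  have h := fz_cast hP ((val_Sm hP hr).mul (hcs.mul hcs))
  rw [Int.cast_mul, Int.cast_mul, val_cast hP, val_cast hP, ← pow_two] at h
  rw [h, fp, ← pow_two, ← mul_assoc, cls_sq _ _ (mul_ne_zero hP0 (val_Sm hP hr).1) hcs.1]
  rfl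

lemma fz_add {P : ℕ} (hP : P.Prime) {r s : ZMod P} (hr : r ≠ 0) (hs : s ≠ 0) (hrs : r + s ≠ 0) :
    fz P r + fz P s = fz P (r + s) + fz P (r * s * (r + s)) := by
  have : NeZero P := ⟨hP.ne_zero⟩
  have hP0 : (P : ℤ) ≠ 0 := by exact_mod_cast hP.ne_zero
  have hr' := val_Sm hP hr
  have hsv := val_Sm hP hs
  obtain ⟨v, hv⟩ : ∃ v : ℤ, v = s.val - P := ⟨_, rfl⟩
  have h1 : (0 : ℤ) < s.val := lt_of_le_of_ne (by positivity) hsv.1.symm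
  have h2 : (s.val : ℤ) < P := by exact_mod_cast ZMod.val_lt s
  have h3 : (0 : ℤ) < r.val := lt_of_le_of_ne (by positivity) hr'.1.symm
  have h4 : (r.val : ℤ) < P := by exact_mod_cast ZMod.val_lt r
  have hvs : Sm P v := Sm.small (by rw [hv]; linarith) (by rw [abs_lt]; constructor <;> linarith)
  have hvc : (v : ZMod P) = s := by rw [hv, Int.cast_sub, val_cast hP]; simp
  have hsum : Sm P (r.val + v) := by
    apply Sm.small
    · intro h
      apply hrs
      have := congrArg (fun x : ℤ => (x : ZMod P)) h
      simpa only [Int.cast_add, val_cast hP, hvc, Int.cast_zero] using this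
    · rw [abs_lt]; constructor <;> linarith
  have e1 := fz_cast hP hvs
  have e2 := fz_cast hP hsum
  have e3 := fz_cast hP ((hr'.mul hvs).mul hsum)
  have e0 : fz P r = fp P r.val := rfl
  simp only [Int.cast_add, Int.cast_mul, val_cast hP, hvc] at e1 e2 e3
  rw [e0, e1, e2, e3]
  have := cls_add (P * r.val) (P * v) (mul_ne_zero hP0 hr'.1) (mul_ne_zero hP0 hvs.1)
    (by rw [← mul_add]; exact mul_ne_zero hP0 hsum.1)
  rw [show (P : ℤ) * r.val * (P * v) * (P * r.val + P * v) =
    (P * (r.val * v * (r.val + v))) * P ^ 2 by ring,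
    cls_sq _ _ (mul_ne_zero hP0 ((hr'.mul hvs).mul hsum).1) hP0, ← mul_add] at this
  have h5 := congrArg (qmk P) this
  rw [map_add, map_add] at h5
  exact h5

lemma fz_red {P : ℕ} (hP : P.Prime) (n : ℕ) : ∀ l : List (ZMod P), l.length = n →
    (∀ x ∈ l, x ≠ 0) → l ≠ [] → l.sum = 0 →
    ∃ l' : List (ZMod P), (∀ x ∈ l', x ≠ 0) ∧ l'.length < l.length ∧
      (l.map (fz P)).sum = (l'.map (fz P)).sum := by
  have := Fact.mk hP
  induction n using Nat.strong_induction_on with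
  | _ n ih =>
    intro l hn hl hne hs
    match l, hne with
    | [a], _ => exact absurd (by simpa using hs) (hl a (by simp))
    | a :: b :: t, _ =>
      have ha : a ≠ 0 := hl a (by simp)
      have hb : b ≠ 0 := hl b (by simp)
      have ht : ∀ x ∈ t, x ≠ 0 := fun x hx => hl x (by simp [hx])
      by_cases hab : a + b = 0
      · refine ⟨t, ht, by simp, ?_⟩
        have : b = -a := by linear_combination hab
        simp [this, fz_neg hP ha]
      · obtain ⟨l', h1, h2, h3⟩ := ih (n - 1) (by rw [← hn]; simp) ((a + b) :: t)
          (by rw [← hn]; simp) (by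
            intro x hx
            rcases List.mem_cons.mp hx with rfl | hx
            · exact hab
            · exact ht x hx) (by simp) (by simpa [add_assoc] using hs)
        refine ⟨(a * b * (a + b)) :: l', ?_, by simp at h2 ⊢; omega, ?_⟩
        · intro x hx
          rcases List.mem_cons.mp hx with rfl | hx
          · exact mul_ne_zero (mul_ne_zero ha hb) hab
          · exact h1 x hx
        · simp only [List.map_cons, List.sum_cons] at h3 ⊢
          rw [← h3, ← add_assoc, fz_add hP ha hb hab]
          abel

lemma fz_red' {P : ℕ} (hP : P.Prime) {k : ℕ} (u c : Fin k → ZMod P) (hu : ∀ i, u i ≠ 0)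
    (hc : ∃ i, c i ≠ 0) (h : ∑ i, u i * c i ^ 2 = 0) :
    ∃ t : Multiset (ZMod P), (∀ x ∈ t, x ≠ 0) ∧ t.card < k ∧
      ∑ i, fz P (u i) = (t.map (fz P)).sum := by
  classical
  have := Fact.mk hP
  set A := Finset.univ.filter (fun i => c i ≠ 0) with hA
  set A' := Finset.univ.filter (fun i => ¬ c i ≠ 0) with hA'
  have hsplit : ∀ {X : Type} [AddCommMonoid X] (g : Fin k → X), ∑ i, g i = ∑ i ∈ A, g i + ∑ i ∈ A', g i :=
    fun g => (Finset.sum_filter_add_sum_filter_not _ _ _).symm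
  have hcard : A.card + A'.card = k := by
    have := Finset.card_filter_add_card_filter_not (s := (Finset.univ : Finset (Fin k))) (fun i => c i ≠ 0)
    simpa only [Finset.card_univ, Fintype.card_fin] using this
  let l := A.toList.map (fun i => u i * c i ^ 2)
  have hAne : A.Nonempty := by
    obtain ⟨i, hi⟩ := hc
    exact ⟨i, by simp [hA, hi]⟩
  have hlA : ∀ {X : Type} [AddCommMonoid X] (g : Fin k → X), (A.toList.map g).sum = ∑ i ∈ A, g i :=
    fun g => Finset.sum_map_toList A g
  obtain ⟨l', h1, h2, h3⟩ := fz_red hP _ l rfl (by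
      intro x hx
      obtain ⟨i, hi, rfl⟩ := List.mem_map.mp hx
      have : c i ≠ 0 := by simpa [hA] using hi
      exact mul_ne_zero (hu i) (pow_ne_zero _ this)) (by
      simpa [l] using hAne.ne_empty) (by
      rw [hlA]
      rw [hsplit] at h
      rw [← h, left_eq_add]
      apply Finset.sum_eq_zero
      intro i hi
      have : c i = 0 := by simpa [hA'] using hi
      simp [this])
  refine ⟨(l' : Multiset (ZMod P)) + A'.val.map u, ?_, ?_, ?_⟩
  · intro x hx
    rcases Multiset.mem_add.mp hx with hx | hx
    · exact h1 x hx
    · obtain ⟨i, _, rfl⟩ := Multiset.mem_map.mp hx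
      exact hu i
  · have : l.length = A.card := by simp [l]
    simp only [Multiset.card_add, Multiset.coe_card, Multiset.card_map, Finset.card_val]
    omega
  · rw [hsplit, Multiset.map_add, Multiset.sum_add, Multiset.map_coe, Multiset.sum_coe, ← h3,
      Multiset.map_map]
    congr 1
    rw [List.map_map, hlA]
    apply Finset.sum_congr rfl
    intro i hi
    have : c i ≠ 0 := by simpa [hA] using hi
    exact (fz_sq hP (hu i) this).symm

lemma fz_gen {P : ℕ} (hP : P.Prime) (n : ℕ) : ∀ s : ℤ, s.natAbs = n → Sm (P + 1) s →
    ∃ t : Multiset (ZMod P), (∀ x ∈ t, x ≠ 0) ∧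
      qmk P (cls s) = (t.map (fz P)).sum := by
  have hP0 : (P : ℤ) ≠ 0 := by exact_mod_cast hP.ne_zero
  have hdown : ∀ s, Sm (P + 1) s → ¬ (P : ℤ) ∣ s → Sm P s := by
    intro s hs hd
    refine ⟨hs.1, fun q hq h => ?_⟩
    have := hs.2 q hq h
    have : q ≠ P := by rintro rfl; exact hd h
    omega
  induction n using Nat.strong_induction_on with
  | _ n ih =>
    intro s hn hs
    by_cases h1 : (P : ℤ) ∣ s
    · obtain ⟨s', rfl⟩ := h1
      have hs0 : s' ≠ 0 := by rintro rfl; exact hs.1 (by simp)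
      have hs' : Sm (P + 1) s' := ⟨hs0, fun q hq h => hs.2 q hq (h.mul_left _)⟩
      by_cases h2 : (P : ℤ) ∣ s'
      · obtain ⟨r, rfl⟩ := h2
        have hr0 : r ≠ 0 := by rintro rfl; exact hs0 (by simp)
        have hr : Sm (P + 1) r := ⟨hr0, fun q hq h => hs'.2 q hq (h.mul_left _)⟩
        have := ih r.natAbs (by
          rw [← hn, Int.natAbs_mul, Int.natAbs_mul, Int.natAbs_natCast]
          have := hP.two_le
          have : 0 < r.natAbs := Int.natAbs_pos.mpr hr0
          nlinarith [Nat.mul_le_mul_right r.natAbs (Nat.mul_le_mul hP.two_le hP.two_le)]) r rfl hr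
        rw [show (P : ℤ) * (P * r) = r * P ^ 2 by ring, cls_sq _ _ hr0 hP0]
        exact this
      · refine ⟨{(s' : ZMod P)}, ?_, ?_⟩
        · simp only [Multiset.mem_singleton, forall_eq]
          rwa [Ne, ZMod.intCast_zmod_eq_zero_iff_dvd _ P] <;> exact ⟨hP.ne_zero⟩
        · simp only [Multiset.map_singleton, Multiset.sum_singleton]
          exact (fz_cast hP (hdown _ hs' h2)).symm
    · exact ⟨0, by simp, by simpa using mk_zero (hdown s hs h1)⟩

lemma fz_FL {P : ℕ} (hP : P.Prime) {x : WG} (hx : x ∈ FL (P + 1)) :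
    ∃ t : Multiset (ZMod P), (∀ x ∈ t, x ≠ 0) ∧
      qmk P x = (t.map (fz P)).sum := by
  obtain ⟨t, ht, rfl⟩ := FL_fam hx
  induction t using Multiset.induction_on with
  | empty => exact ⟨0, by simp, by simp⟩
  | cons a t ih =>
    obtain ⟨l, h1, h2⟩ := ih (fun s hs => ht s (by simp [hs])) (by
      apply AddSubgroup.multiset_sum_mem
      intro y hy
      obtain ⟨s, hs, rfl⟩ := Multiset.mem_map.mp hy
      exact FL_mem (ht s (by simp [hs])))
    obtain ⟨l', h1', h2'⟩ := fz_gen hP _ a rfl (ht a (by simp))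
    refine ⟨l' + l, ?_, ?_⟩
    · intro x hx
      rcases Multiset.mem_add.mp hx with hx | hx
      · exact h1' x hx
      · exact h1 x hx
    · rw [Multiset.map_cons, Multiset.sum_cons, map_add, h2, h2', Multiset.map_add,
        Multiset.sum_add]

lemma descend {P : ℕ} (hP : P.Prime) (x : WG) (hx : x ∈ FL (P + 1))
    (H : ∀ (m : ℕ) (b : Fin m → ℤ) (k : ℕ) (u : Fin k → ℤ), (∀ i, Sm P (b i)) →
      (∀ i, Sm P (u i)) → 0 < k →
      x = ∑ i, cls (b i) + ∑ j, cls (P * u j) →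
      ∃ c : Fin k → ℤ, (∃ j, ¬ (P : ℤ) ∣ c j) ∧ (P : ℤ) ∣ ∑ j, u j * c j ^ 2) :
    x ∈ FL P := by
  have : NeZero P := ⟨hP.ne_zero⟩
  obtain ⟨t, ht, hxt⟩ := fz_FL hP hx
  induction hn : t.card using Nat.strong_induction_on generalizing t with
  | _ n ih =>
    obtain ⟨k, v, rfl⟩ := fam_exists t
    have hv : ∀ i, v i ≠ 0 := fun i => ht _ (Multiset.mem_map_of_mem _ (Finset.mem_univ_val i))
    have hsum : (Multiset.map (fz P) (Multiset.map v Finset.univ.val)).sum = ∑ i, fz P (v i) := by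
      rw [Multiset.map_map]; rfl
    rw [hsum] at hxt
    have hk : k = n := by simpa using hn
    rcases Nat.eq_zero_or_pos k with h0 | hkpos
    · subst h0
      apply (qmk_zero _).mp
      simpa using hxt
    · have hmem : x - ∑ i, cls (P * (v i).val) ∈ FL P := by
        apply (qmk_zero _).mp
        rw [map_sub, hxt, sub_eq_zero]
        exact (map_sum (qmk P) (fun i => cls (P * (v i).val)) Finset.univ).symm
      obtain ⟨t, ht, he⟩ := FL_fam hmem
      obtain ⟨m, b, rfl⟩ := fam_exists t
      obtain ⟨c, ⟨j, hj⟩, hc⟩ := H m b k (fun i => (v i).val)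
        (fun i => ht _ (Multiset.mem_map_of_mem _ (Finset.mem_univ_val i)))
        (fun i => val_Sm hP (hv i)) hkpos (by
          rw [sub_eq_iff_eq_add] at he
          rw [he, Multiset.map_map]
          rfl)
      obtain ⟨t', h1, h2, h3⟩ := fz_red' hP v (fun i => (c i : ZMod P)) hv
        ⟨j, by rwa [Ne, ZMod.intCast_zmod_eq_zero_iff_dvd]⟩ (by
          rw [← ZMod.intCast_zmod_eq_zero_iff_dvd] at hc
          simpa using hc)
      exact ih t'.card (by omega) t' h1 (hxt.trans h3) rfl

lemma FL_nonprime {n : ℕ} (hn : ¬ n.Prime) {x : WG} (hx : x ∈ FL (n + 1)) : x ∈ FL n := by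
  refine AddSubgroup.closure_mono ?_ hx
  rintro _ ⟨s, hs, rfl⟩
  refine ⟨s, ⟨hs.1, fun q hq h => ?_⟩, rfl⟩
  have := hs.2 q hq h
  have : q ≠ n := by rintro rfl; exact hn hq
  omega

lemma FL_two {x : WG} (hx : x ∈ FL 2) : ∃ s : ℤ, x = s • cls 1 := by
  induction hx using AddSubgroup.closure_induction with
  | mem x hx =>
    obtain ⟨s, hs, rfl⟩ := hx
    have : s.natAbs = 1 := by
      by_contra h
      have := hs.2 _ (Nat.minFac_prime h) (by
        rw [Int.natCast_dvd]; exact Nat.minFac_dvd _)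
      have := (Nat.minFac_prime h).two_le
      omega
    rcases Int.natAbs_eq_iff.mp this with h | h
    · exact ⟨1, by rw [h]; simp⟩
    · exact ⟨-1, by rw [h]; simp [cls_neg]⟩
  | zero => exact ⟨0, by simp⟩
  | add x y _ _ h1 h2 =>
    obtain ⟨s, rfl⟩ := h1
    obtain ⟨t, rfl⟩ := h2
    exact ⟨s + t, (add_zsmul _ _ _).symm⟩
  | neg x _ h =>
    obtain ⟨s, rfl⟩ := h
    exact ⟨-s, (neg_zsmul _ _).symm⟩

lemma FL_exists {ι : Type} [Fintype ι] (a : ι → ℤ) (ha : ∀ i, a i ≠ 0) :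
    ∃ N, ∑ i, cls (a i) ∈ FL N := by
  refine ⟨(∑ i, (a i).natAbs) + 1, AddSubgroup.sum_mem _ (fun i _ => FL_mem ⟨ha i, ?_⟩)⟩
  intro q hq h
  have h1 := Nat.le_of_dvd (Int.natAbs_pos.mpr (ha i)) (Int.natCast_dvd.mp h)
  have h2 := Finset.single_le_sum (f := fun i => (a i).natAbs) (fun _ _ => Nat.zero_le _) (Finset.mem_univ i)
  omega

end IUL

namespace IUL
open Matrix Module

/-- integer vectors with a common denominator -/
lemma clear_den {ι : Type} [Fintype ι] (x : ι → ℚ) :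
    ∃ (d : ℤ) (z : ι → ℤ), d ≠ 0 ∧ ∀ i, (z i : ℚ) = d * x i := by
  classical
  refine ⟨∏ i, ((x i).den : ℤ), fun i => (∏ j ∈ Finset.univ.erase i, ((x j).den : ℤ)) * (x i).num,
    ?_, ?_⟩
  · exact Finset.prod_ne_zero_iff.mpr (fun i _ => by exact_mod_cast (x i).den_ne_zero)
  · intro i
    rw [← Finset.prod_erase_mul _ _ (Finset.mem_univ i)]
    push_cast
    rw [mul_assoc, Rat.den_mul_eq_num]

/-- coordinatewise cast -/
def castL (ι : Type) : (ι → ℤ) →ₗ[ℤ] (ι → ℚ) where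
  toFun x i := x i
  map_add' := by intro x y; ext i; simp
  map_smul' := by intro x y; ext i; simp

lemma form_cast {ι R : Type} [Fintype ι] [CommRing R] (N : Matrix ι ι ℤ) (x y : ι → ℤ) :
    ((x ⬝ᵥ N *ᵥ y : ℤ) : R) =
      (fun i => (x i : R)) ⬝ᵥ (N.map (Int.cast : ℤ → R)) *ᵥ (fun i => (y i : R)) := by
  simp [dotProduct, mulVec]

lemma p_lemma {ι κ : Type} [Fintype ι] [Fintype κ] [DecidableEq ι] [DecidableEq κ] [Nonempty κ]
    {p : ℕ} (hp : p.Prime) (N : Matrix ι ι ℤ) (hN : ¬ (p : ℤ) ∣ N.det) (u : κ → ℤ)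
    (hm : Met (fromBlocks (N.map (Int.cast : ℤ → ℚ)) 0 0 (dg (fun j => p * u j)))) :
    ∃ c : κ → ℤ, (∃ j, ¬ (p : ℤ) ∣ c j) ∧ (p : ℤ) ∣ ∑ j, u j * c j ^ 2 := by
  by_contra hcon
  push Not at hcon
  have haniso : ∀ c : κ → ℤ, (p : ℤ) ∣ ∑ j, u j * c j ^ 2 → ∀ j, (p : ℤ) ∣ c j := by
    intro c hc j
    by_contra h
    exact hcon c ⟨j, h⟩ hc
  have hfact := Fact.mk hp
  have hp0 : (p : ℤ) ≠ 0 := by exact_mod_cast hp.ne_zero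
  obtain ⟨U, hU, hUd⟩ := hm
  have hform : ∀ x y : ι ⊕ κ → ℤ, castL _ x ∈ U → castL _ y ∈ U →
      (x ∘ Sum.inl) ⬝ᵥ N *ᵥ (y ∘ Sum.inl) + p * ∑ j, u j * x (Sum.inr j) * y (Sum.inr j) = 0 := by
    intro x y hx hy
    have h := hU _ hx _ hy
    have h2 : (castL _ x) ⬝ᵥ (fromBlocks (N.map (Int.cast : ℤ → ℚ)) 0 0
        (dg (fun j => p * u j))) *ᵥ (castL _ y) =
      (fun i => ((x ∘ Sum.inl) i : ℚ)) ⬝ᵥ (N.map (Int.cast : ℤ → ℚ)) *ᵥ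
        (fun i => ((y ∘ Sum.inl) i : ℚ)) +
      (fun j => (x (Sum.inr j) : ℚ)) ⬝ᵥ dg (fun j => p * u j) *ᵥ (fun j => (y (Sum.inr j) : ℚ)) := by
      rw [Matrix.fromBlocks_mulVec]
      simp [dotProduct, Fintype.sum_sum_type, castL, Function.comp_def]
    rw [h2, dg_app, ← form_cast] at h
    have h3 : (((x ∘ Sum.inl) ⬝ᵥ N *ᵥ (y ∘ Sum.inl) +
        ∑ j, p * u j * x (Sum.inr j) * y (Sum.inr j) : ℤ) : ℚ) = 0 := by
      rw [← h]; push_cast; rfl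
    have h4 : (x ∘ Sum.inl) ⬝ᵥ N *ᵥ (y ∘ Sum.inl) +
        ∑ j, p * u j * x (Sum.inr j) * y (Sum.inr j) = 0 := by exact_mod_cast h3
    rw [← h4, Finset.mul_sum]
    congr 1
    exact Finset.sum_congr rfl (fun j _ => by ring)
  let Λ : Submodule ℤ (ι ⊕ κ → ℤ) := (U.restrictScalars ℤ).comap (castL _)
  have hΛ : ∀ x, x ∈ Λ ↔ castL _ x ∈ U := fun x => Iff.rfl
  obtain ⟨r, b⟩ := Submodule.basisOfPid (Pi.basisFun ℤ (ι ⊕ κ)) Λ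
  have hbspan : ∀ z ∈ Λ, ∃ c : Fin r → ℤ, z = ∑ i, c i • (b i : ι ⊕ κ → ℤ) := by
    intro z hz
    refine ⟨b.repr ⟨z, hz⟩, ?_⟩
    have := congrArg (Λ.subtype) (b.sum_repr ⟨z, hz⟩)
    rw [map_sum] at this
    simp only [map_smul, Submodule.subtype_apply] at this
    exact this.symm
  have hbind : ∀ c : Fin r → ℤ, ∑ i, c i • (b i : ι ⊕ κ → ℤ) = 0 → ∀ i, c i = 0 := by
    intro c hc
    have := Fintype.linearIndependent_iff.mp b.linearIndependent c (by
      apply Subtype.ext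
      simpa using hc)
    exact this
  -- rank bound
  have hr : finrank ℚ U ≤ r := by
    have hle : U ≤ Submodule.span ℚ (Set.range (fun i : Fin r => castL _ (b i : ι ⊕ κ → ℤ))) := by
      intro x hx
      obtain ⟨d, z, hd, hz⟩ := clear_den x
      have hzx : castL _ z = (d : ℚ) • x := by ext i; simpa [castL] using hz i
      have hzΛ : z ∈ Λ := by rw [hΛ, hzx]; exact U.smul_mem _ hx
      obtain ⟨c, hc⟩ := hbspan z hzΛ
      have hd' : (d : ℚ) ≠ 0 := by exact_mod_cast hd
      have : x = (d : ℚ)⁻¹ • castL _ z := by rw [hzx, smul_smul, inv_mul_cancel₀ hd', one_smul]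
      rw [this]
      apply Submodule.smul_mem
      rw [hc, map_sum]
      apply Submodule.sum_mem
      intro i _
      rw [map_smul, ← Int.cast_smul_eq_zsmul ℚ]
      exact Submodule.smul_mem _ _ (Submodule.subset_span ⟨i, rfl⟩)
    refine (Submodule.finrank_mono hle).trans ?_
    have := finrank_range_le_card (R := ℚ) (fun i : Fin r => castL _ (b i : ι ⊕ κ → ℤ))
    rw [Fintype.card_fin] at this
    exact this
  -- reductions
  let w : Fin r → ι → ZMod p := fun i j => ((b i : ι ⊕ κ → ℤ) (Sum.inl j) : ZMod p)
  have hw : LinearIndependent (ZMod p) w := by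
    rw [Fintype.linearIndependent_iff]
    intro g hg
    let gh : Fin r → ℤ := fun i => ((g i).val : ℤ)
    have hgh : ∀ i, (gh i : ZMod p) = g i := fun i => val_cast hp (g i)
    let z : ι ⊕ κ → ℤ := ∑ i, gh i • (b i : ι ⊕ κ → ℤ)
    have hzΛ : z ∈ Λ := Λ.sum_mem (fun i _ => Λ.smul_mem _ (b i).2)
    have hz0 : ∀ j, (p : ℤ) ∣ z (Sum.inl j) := by
      intro j
      rw [← ZMod.intCast_zmod_eq_zero_iff_dvd]
      have := congrFun hg j
      simp only [Finset.sum_apply, Pi.smul_apply, smul_eq_mul, Pi.zero_apply, w] at this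
      rw [← this]
      simp [z, hgh]
    choose z0 hz0' using hz0
    have hz1 : ∀ j, (p : ℤ) ∣ z (Sum.inr j) := by
      apply haniso
      have h := hform z z hzΛ hzΛ
      have e : z ∘ Sum.inl = (p : ℤ) • z0 := by ext j; simp [hz0']
      rw [e, mulVec_smul, smul_dotProduct, dotProduct_smul, smul_eq_mul, smul_eq_mul, ← mul_add] at h
      have h := (mul_eq_zero.mp h).resolve_left hp0
      refine ⟨-(z0 ⬝ᵥ N *ᵥ z0), ?_⟩
      have e2 : ∑ j, u j * z (Sum.inr j) * z (Sum.inr j) = ∑ j, u j * z (Sum.inr j) ^ 2 :=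
        Finset.sum_congr rfl (fun j _ => by ring)
      rw [e2] at h
      linear_combination h
    choose z1 hz1' using hz1
    have hzz : z = (p : ℤ) • Sum.elim z0 z1 := by
      ext (j | j)
      · simp [hz0']
      · simp [hz1']
    have hz'Λ : Sum.elim z0 z1 ∈ Λ := by
      rw [hΛ]
      rw [hΛ, hzz, map_smul, ← Int.cast_smul_eq_zsmul ℚ] at hzΛ
      exact (Submodule.smul_mem_iff _ (by exact_mod_cast hp0)).mp hzΛ
    obtain ⟨c, hc⟩ := hbspan _ hz'Λ
    have := hbind (fun i => gh i - p * c i) (by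
      simp only [sub_smul, Finset.sum_sub_distrib, mul_smul, ← Finset.smul_sum, ← hc]
      rw [sub_eq_zero]; exact hzz)
    intro i
    have hi := this i
    rw [← hgh i, ZMod.intCast_zmod_eq_zero_iff_dvd]
    exact ⟨c i, by linarith⟩
  have hdet : (N.map (Int.cast : ℤ → ZMod p)).det ≠ 0 := by
    have : (N.map (Int.cast : ℤ → ZMod p)).det = ((N.det : ℤ) : ZMod p) :=
      ((Int.castRingHom (ZMod p)).map_det N).symm
    rw [this, Ne, ZMod.intCast_zmod_eq_zero_iff_dvd]
    exact hN
  have hiso : ∀ x ∈ Submodule.span (ZMod p) (Set.range w), ∀ y ∈ Submodule.span (ZMod p) (Set.range w),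
      x ⬝ᵥ (N.map (Int.cast : ℤ → ZMod p)) *ᵥ y = 0 := by
    intro x hx y hy
    induction hx using Submodule.span_induction with
    | mem x hx =>
      obtain ⟨i, rfl⟩ := hx
      induction hy using Submodule.span_induction with
      | mem y hy =>
        obtain ⟨j, rfl⟩ := hy
        have h := hform (b i) (b j) (b i).2 (b j).2
        have h2 := congrArg (fun t : ℤ => (t : ZMod p)) h
        simp only [Int.cast_add, Int.cast_mul, Int.cast_natCast, CharP.cast_eq_zero, zero_mul,
          add_zero, Int.cast_zero] at h2
        rw [form_cast] at h2
        exact h2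
      | zero => simp
      | add y y' _ _ h1 h2 => rw [mulVec_add, dotProduct_add, h1, h2, add_zero]
      | smul t y _ h => rw [mulVec_smul, dotProduct_smul, h, smul_zero]
    | zero => simp
    | add y y' _ _ h1 h2 => rw [add_dotProduct, h1, h2, add_zero]
    | smul t y _ h => rw [smul_dotProduct, h, smul_zero]
  have hb := iso_bound _ hdet _ hiso
  rw [finrank_span_eq_card hw, Fintype.card_fin] at hb
  rw [Fintype.card_sum] at hUd
  have : 0 < Fintype.card κ := Fintype.card_pos
  omega

/-- orthogonal families give diagonalizations over every field of characteristic zero -/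
lemma orth_equiv (K : Type) [Field K] [CharZero K] {n : ℕ} {ι : Type} [Fintype ι] [DecidableEq ι]
    (M : Matrix (Fin n) (Fin n) ℤ) (v : ι → Fin n → ℤ) (a : ι → ℤ) (hc : Fintype.card ι = n)
    (ha : ∀ i, a i ≠ 0) (hv : ∀ i j, v i ⬝ᵥ M *ᵥ v j = if i = j then a i else 0) :
    ∃ e : (ι → K) ≃ₗ[K] (Fin n → K), ∀ x y,
      e x ⬝ᵥ (M.map (Int.cast : ℤ → K)) *ᵥ e y = ∑ i, (a i : K) * x i * y i := by
  let f : (ι → K) →ₗ[K] (Fin n → K) := Fintype.linearCombination K (fun i j => (v i j : K))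
  have hf : ∀ x, f x = ∑ i, x i • (fun j => (v i j : K)) := fun x => rfl
  have hform : ∀ x y, f x ⬝ᵥ (M.map (Int.cast : ℤ → K)) *ᵥ f y = ∑ i, (a i : K) * x i * y i := by
    intro x y
    rw [hf, hf, sum_dotProduct]
    apply Finset.sum_congr rfl
    intro i _
    rw [mulVec_sum, dotProduct_sum, Finset.sum_eq_single i]
    · rw [smul_dotProduct, mulVec_smul, dotProduct_smul, ← form_cast, hv, if_pos rfl]
      simp only [smul_eq_mul]; ring
    · intro j _ hj
      rw [smul_dotProduct, mulVec_smul, dotProduct_smul, ← form_cast, hv, if_neg (Ne.symm hj)]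
      simp
    · simp
  have hinj : Function.Injective f := by
    rw [← LinearMap.ker_eq_bot, LinearMap.ker_eq_bot']
    intro x hx
    ext i
    have h := hform x (Pi.single i 1)
    rw [hx, zero_dotProduct, Finset.sum_eq_single i] at h
    · have := ha i
      simpa [this] using h.symm
    · intro j _ hj; simp [hj]
    · simp
  refine ⟨LinearEquiv.ofInjectiveOfFinrankEq f hinj (by simp [hc]), ?_⟩
  intro x y
  exact hform x y

lemma exists_orth {n : ℕ} (M : Matrix (Fin n) (Fin n) ℤ) (hs : M.IsSymm) (hd : M.det ≠ 0) :
    ∃ (v : Fin n → Fin n → ℤ) (a : Fin n → ℤ), (∀ i, a i ≠ 0) ∧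
      ∀ i j, v i ⬝ᵥ M *ᵥ v j = if i = j then a i else 0 := by
  let Q := M.map (Int.cast : ℤ → ℚ)
  have hQs : Q.IsSymm := hs.map _
  have hsymm : LinearMap.IsSymm (Matrix.toBilin' Q) := by
    constructor
    intro x y
    simp only [RingHom.id_apply, Matrix.toBilin'_apply']
    rw [dotProduct_mulVec, ← mulVec_transpose, hQs.eq, dotProduct_comm]
  obtain ⟨b0, hb0⟩ := LinearMap.BilinForm.exists_orthogonal_basis hsymm
  let b := b0.reindex (finCongr (by simp : finrank ℚ (Fin n → ℚ) = n))
  have hb : ∀ i j, i ≠ j → b i ⬝ᵥ Q *ᵥ b j = 0 := by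
    intro i j hij
    have := LinearMap.isOrthoᵢ_def.mp hb0 ((finCongr (by simp : finrank ℚ (Fin n → ℚ) = n)).symm i)
      ((finCongr (by simp : finrank ℚ (Fin n → ℚ) = n)).symm j) (by simpa using hij)
    rw [Matrix.toBilin'_apply'] at this
    simpa [b] using this
  have hQd : Q.det ≠ 0 := by
    have : Q.det = ((M.det : ℤ) : ℚ) := ((Int.castRingHom ℚ).map_det M).symm
    rw [this]; exact_mod_cast hd
  choose d v hd0 hv using fun i => clear_den (b i)
  have hvb : ∀ i, (fun j => (v i j : ℚ)) = (d i : ℚ) • b i := by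
    intro i; ext j; simp [hv]
  refine ⟨v, fun i => v i ⬝ᵥ M *ᵥ v i, ?_, ?_⟩
  · intro i h
    have h : v i ⬝ᵥ M *ᵥ v i = 0 := h
    have h1 : ((v i ⬝ᵥ M *ᵥ v i : ℤ) : ℚ) = 0 := by rw [h]; simp
    have hdi : (d i : ℚ) ≠ 0 := by exact_mod_cast hd0 i
    rw [form_cast, hvb, smul_dotProduct, mulVec_smul, dotProduct_smul] at h1
    have h2 : b i ⬝ᵥ Q *ᵥ b i = 0 := by simpa [hdi] using h1
    have h3 : ∀ y, b i ⬝ᵥ Q *ᵥ y = 0 := by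
      intro y
      rw [← b.sum_repr y, mulVec_sum, dotProduct_sum]
      apply Finset.sum_eq_zero
      intro j _
      rw [mulVec_smul, dotProduct_smul]
      by_cases hij : i = j
      · subst hij; rw [h2, smul_zero]
      · rw [hb i j hij, smul_zero]
    have hnd := LinearMap.BilinForm.nondegenerate_toBilin'_iff_det_ne_zero.mpr hQd
    have h4 : b i = 0 := hnd.1 (b i) (fun y => by rw [Matrix.toBilin'_apply']; exact h3 y)
    exact b.ne_zero i h4
  · intro i j
    split_ifs with h
    · rw [h]
    · have : ((v i ⬝ᵥ M *ᵥ v j : ℤ) : ℚ) = 0 := by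
        rw [form_cast, hvb, hvb, smul_dotProduct, mulVec_smul, dotProduct_smul]
        have := hb i j h
        simp only [Q] at this
        rw [this]; simp
      exact_mod_cast this

end IUL

namespace IUL
open Matrix Module

/-- block equivalence -/
noncomputable def blk {ι ι' κ : Type} (e : (ι → ℚ) ≃ₗ[ℚ] (ι' → ℚ)) : (ι ⊕ κ → ℚ) ≃ₗ[ℚ] (ι' ⊕ κ → ℚ) :=
  (LinearEquiv.sumArrowLequivProdArrow ι κ ℚ ℚ).trans
    ((e.prodCongr (LinearEquiv.refl ℚ (κ → ℚ))).trans
      (LinearEquiv.sumArrowLequivProdArrow ι' κ ℚ ℚ).symm)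

lemma blk_inl {ι ι' κ : Type} (e : (ι → ℚ) ≃ₗ[ℚ] (ι' → ℚ)) (x : ι ⊕ κ → ℚ) :
    (blk e x) ∘ Sum.inl = e (x ∘ Sum.inl) := rfl

lemma blk_inr {ι ι' κ : Type} (e : (ι → ℚ) ≃ₗ[ℚ] (ι' → ℚ)) (x : ι ⊕ κ → ℚ) :
    (blk e x) ∘ Sum.inr = x ∘ Sum.inr := rfl

lemma block_app {ι κ : Type} [Fintype ι] [Fintype κ] (N : Matrix ι ι ℚ) (R : Matrix κ κ ℚ)
    (x y : ι ⊕ κ → ℚ) : x ⬝ᵥ (fromBlocks N 0 0 R) *ᵥ y =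
      (x ∘ Sum.inl) ⬝ᵥ N *ᵥ (y ∘ Sum.inl) + (x ∘ Sum.inr) ⬝ᵥ R *ᵥ (y ∘ Sum.inr) := by
  rw [Matrix.fromBlocks_mulVec]
  simp [dotProduct, Fintype.sum_sum_type, Function.comp_def]

lemma block_form {ι ι' κ : Type} [Fintype ι] [Fintype ι'] [Fintype κ] (M : Matrix ι ι ℚ)
    (N : Matrix ι' ι' ℚ) (R : Matrix κ κ ℚ) (e : (ι → ℚ) ≃ₗ[ℚ] (ι' → ℚ))
    (he : ∀ x y, e x ⬝ᵥ N *ᵥ e y = x ⬝ᵥ M *ᵥ y) (x y : ι ⊕ κ → ℚ) :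
    blk e x ⬝ᵥ (fromBlocks N 0 0 R) *ᵥ blk e y = x ⬝ᵥ (fromBlocks M 0 0 R) *ᵥ y := by
  rw [block_app, block_app, blk_inl, blk_inl, blk_inr, blk_inr, he]

lemma witt_step {n : ℕ} (M : Matrix (Fin n) (Fin n) ℤ) (hu : M.det = 1 ∨ M.det = -1)
    (v : Fin n → Fin n → ℤ) (a : Fin n → ℤ) (ha : ∀ i, a i ≠ 0)
    (hv : ∀ i j, v i ⬝ᵥ M *ᵥ v j = if i = j then a i else 0) {P : ℕ} (hP : P.Prime)
    (hx : ∑ i, cls (a i) ∈ FL (P + 1)) : ∑ i, cls (a i) ∈ FL P := by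
  have hP0 : (P : ℤ) ≠ 0 := by exact_mod_cast hP.ne_zero
  refine descend hP _ hx ?_
  intro m b k u hb hu' hk he
  have h0 : ∑ i, cls ((Sum.elim (Sum.elim a (fun i => - b i)) (fun j => P * (- u j))) i) = 0 := by
    simp only [Fintype.sum_sum_type, Sum.elim_inl, Sum.elim_inr]
    have h1 : ∑ i, cls (- b i) = - ∑ i, cls (b i) := by
      rw [← Finset.sum_neg_distrib]
      exact Finset.sum_congr rfl (fun i _ => cls_neg _ (hb i).1)
    have h2 : ∑ j, cls (P * (- u j)) = - ∑ j, cls (P * u j) := by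
      rw [← Finset.sum_neg_distrib]
      refine Finset.sum_congr rfl (fun i _ => ?_)
      rw [mul_neg, cls_neg _ (mul_ne_zero hP0 (hu' i).1)]
    rw [h1, h2, he]; abel
  have hm := met_of_sum_zero _ (by
    rintro ((i | i) | i)
    · exact ha i
    · exact neg_ne_zero.mpr (hb i).1
    · exact mul_ne_zero hP0 (neg_ne_zero.mpr (hu' i).1)) h0
  rw [← dg_sum, ← dg_sum] at hm
  obtain ⟨e, he'⟩ := orth_equiv ℚ M v a (by simp) ha hv
  have hm2 := met_equiv _ (fromBlocks (fromBlocks (M.map (Int.cast : ℤ → ℚ)) 0 0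
    (dg (fun i => - b i))) 0 0 (dg (fun j => P * (- u j)))) _
    (block_form _ _ _ _ (block_form (dg a) _ _ e (fun x y => by rw [he', dg_app]))) hm
  have hN : fromBlocks (M.map (Int.cast : ℤ → ℚ)) 0 0 (dg (fun i => - b i)) =
      (fromBlocks M 0 0 (diagonal (fun i => - b i))).map (Int.cast : ℤ → ℚ) := by
    rw [fromBlocks_map, dg, diagonal_map (by simp)]
    congr 1 <;> ext <;> simp
  rw [hN] at hm2
  have : Nonempty (Fin k) := ⟨⟨0, hk⟩⟩
  obtain ⟨c, hc, hd⟩ := p_lemma hP _ (by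
    rw [det_fromBlocks_zero₂₁, det_diagonal]
    intro h
    have hp := Nat.prime_iff_prime_int.mp hP
    rcases hp.dvd_or_dvd h with h | h
    · have : (P : ℤ) ∣ 1 := by
        rcases hu with hu | hu <;> rw [hu] at h
        · exact h
        · exact (dvd_neg).mp h
      exact hp.not_unit (isUnit_of_dvd_one this)
    · obtain ⟨i, _, hi⟩ := (Prime.dvd_finset_prod_iff hp _).mp h
      exact (hb i).not_dvd hP ((dvd_neg).mp hi)) _ hm2
  refine ⟨c, hc, ?_⟩
  have : ∑ j, u j * c j ^ 2 = - ∑ j, - u j * c j ^ 2 := by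
    rw [← Finset.sum_neg_distrib]; exact Finset.sum_congr rfl (fun j _ => by ring)
  rw [this]; exact (dvd_neg).mpr hd

lemma witt_one {n : ℕ} (M : Matrix (Fin n) (Fin n) ℤ) (hu : M.det = 1 ∨ M.det = -1)
    (v : Fin n → Fin n → ℤ) (a : Fin n → ℤ) (ha : ∀ i, a i ≠ 0)
    (hv : ∀ i j, v i ⬝ᵥ M *ᵥ v j = if i = j then a i else 0) :
    ∃ s : ℤ, ∑ i, cls (a i) = s • cls 1 := by
  obtain ⟨N, hN⟩ := FL_exists a ha
  apply FL_two
  have hstep : ∀ m, ∑ i, cls (a i) ∈ FL (m + 1) → ∑ i, cls (a i) ∈ FL m := by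
    intro m hm
    by_cases hp : m.Prime
    · exact witt_step M hu v a ha hv hp hm
    · exact FL_nonprime hp hm
  have h0 : ∑ i, cls (a i) ∈ FL 0 := by
    induction N with
    | zero => exact hN
    | succ N ih => exact ih (hstep _ hN)
  refine AddSubgroup.closure_mono ?_ h0
  rintro _ ⟨s, hs, rfl⟩
  exact ⟨s, ⟨hs.1, fun q hq h => absurd (hs.2 q hq h) (by omega)⟩, rfl⟩

lemma diag_iso {n : ℕ} (a : Fin n → ℤ) (ha : ∀ i, a i ≠ 0) (hp : ∃ i, 0 < a i)
    (hn : ∃ i, a i < 0) (s : ℤ) (h : ∑ i, cls (a i) = s • cls 1) :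
    ∃ x : Fin n → ℚ, x ≠ 0 ∧ ∑ i, (a i : ℚ) * x i * x i = 0 := by
  obtain ⟨t, ε, hε, h0⟩ : ∃ (t : ℕ) (ε : ℤ), (ε = 1 ∨ ε = -1) ∧
      ∑ i, cls (a i) + t • cls ε = 0 := by
    obtain ⟨t, rfl | rfl⟩ := s.eq_nat_or_neg
    · refine ⟨t, -1, Or.inr rfl, ?_⟩
      rw [h, cls_neg 1 one_ne_zero]; simp
    · refine ⟨t, 1, Or.inl rfl, ?_⟩
      rw [h]; simp
  have hε0 : ε ≠ 0 := by rcases hε with rfl | rfl <;> norm_num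
  obtain ⟨U, hU, hUd⟩ := met_of_sum_zero (Sum.elim a (fun _ : Fin t => ε)) (by
    rintro (i | i)
    · exact ha i
    · exact hε0) (by
    rw [← h0]; simp [Fintype.sum_sum_type])
  have hform : ∀ x ∈ U, ∑ i, (a i : ℚ) * x (Sum.inl i) * x (Sum.inl i) +
      ∑ j : Fin t, (ε : ℚ) * x (Sum.inr j) * x (Sum.inr j) = 0 := by
    intro x hx
    have := hU x hx x hx
    rw [dg_app, Fintype.sum_sum_type] at this
    exact this
  have h1 : finrank ℚ U ≤ Fintype.card {i // ε * a i < 0} := by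
    let f : (Fin n ⊕ Fin t → ℚ) →ₗ[ℚ] ({i // ε * a i < 0} → ℚ) :=
      LinearMap.funLeft ℚ ℚ (fun i => Sum.inl i.1)
    have hf : Function.Injective (f.domRestrict U) := by
      rw [← LinearMap.ker_eq_bot, LinearMap.ker_eq_bot']
      rintro ⟨x, hx⟩ hx0
      have hx1 : ∀ i, ε * a i < 0 → x (Sum.inl i) = 0 := fun i hi => congrFun hx0 ⟨i, hi⟩
      have hs := hform x hx
      have hεε : (ε : ℚ) * ε = 1 := by rcases hε with rfl | rfl <;> norm_num
      have hs2 : ∑ i, ((ε * a i : ℤ) : ℚ) * x (Sum.inl i) ^ 2 + ∑ j : Fin t, x (Sum.inr j) ^ 2 = 0 := by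
        have := congrArg (fun z => (ε : ℚ) * z) hs
        simp only [mul_add, Finset.mul_sum, mul_zero] at this
        rw [← this]
        congr 1
        · exact Finset.sum_congr rfl (fun i _ => by push_cast; ring)
        · exact Finset.sum_congr rfl (fun i _ => by linear_combination (- x (Sum.inr i) ^ 2) * hεε)
      have hp1 : ∀ i ∈ Finset.univ, 0 ≤ ((ε * a i : ℤ) : ℚ) * x (Sum.inl i) ^ 2 := by
        intro i _
        by_cases hi : ε * a i < 0
        · simp [hx1 i hi]
        · have : (0 : ℚ) ≤ ((ε * a i : ℤ) : ℚ) := by exact_mod_cast not_lt.mp hi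
          positivity
      have hp2 : ∀ j ∈ (Finset.univ : Finset (Fin t)), 0 ≤ x (Sum.inr j) ^ 2 := fun j _ => sq_nonneg _
      have hq1 := Finset.sum_nonneg hp1
      have hq2 := Finset.sum_nonneg hp2
      have z1 := (Finset.sum_eq_zero_iff_of_nonneg hp1).mp (by linarith)
      have z2 := (Finset.sum_eq_zero_iff_of_nonneg hp2).mp (by linarith)
      apply Subtype.ext
      funext k
      rcases k with i | j
      · have := z1 i (Finset.mem_univ _)
        have hne : ((ε * a i : ℤ) : ℚ) ≠ 0 := by exact_mod_cast mul_ne_zero hε0 (ha i)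
        rcases mul_eq_zero.mp this with h | h
        · exact absurd h hne
        · simpa using h
      · simpa using z2 j (Finset.mem_univ _)
    have := LinearMap.finrank_le_finrank_of_injective hf
    simpa using this
  have h2 : Fintype.card {i // ε * a i < 0} < n := by
    have : ∃ i, ¬ ε * a i < 0 := by
      rcases hε with rfl | rfl
      · obtain ⟨i, hi⟩ := hp; exact ⟨i, by linarith⟩
      · obtain ⟨i, hi⟩ := hn; exact ⟨i, by linarith⟩
    obtain ⟨i, hi⟩ := this
    have := Fintype.card_subtype_lt (p := fun i => ε * a i < 0) hi
    simpa using this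
  simp only [Fintype.card_sum, Fintype.card_fin] at hUd
  let g : (Fin n ⊕ Fin t → ℚ) →ₗ[ℚ] (Fin t → ℚ) := LinearMap.funLeft ℚ ℚ Sum.inr
  have hk : LinearMap.ker (g.domRestrict U) ≠ ⊥ := by
    apply LinearMap.ker_ne_bot_of_finrank_lt
    rw [finrank_fintype_fun_eq_card, Fintype.card_fin]
    omega
  obtain ⟨⟨x, hx⟩, hxk, hx0⟩ := (Submodule.ne_bot_iff _).mp hk
  have hr : ∀ j, x (Sum.inr j) = 0 := fun j => congrFun (LinearMap.mem_ker.mp hxk) j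
  refine ⟨x ∘ Sum.inl, ?_, ?_⟩
  · intro h
    apply hx0
    apply Subtype.ext
    funext k
    rcases k with i | j
    · exact congrFun h i
    · exact hr j
  · have := hform x hx
    simpa [hr] using this

theorem isotropy {n : ℕ} (M : Matrix (Fin n) (Fin n) ℤ) (hs : M.IsSymm)
    (hu : M.det = 1 ∨ M.det = -1) (hp : ∃ x : Fin n → ℤ, 0 < x ⬝ᵥ M *ᵥ x)
    (hn : ∃ x : Fin n → ℤ, x ⬝ᵥ M *ᵥ x < 0) : ∃ z : Fin n → ℤ, z ≠ 0 ∧ z ⬝ᵥ M *ᵥ z = 0 := by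
  obtain ⟨v, a, ha, hv⟩ := exists_orth M hs (by rcases hu with h | h <;> rw [h] <;> norm_num)
  obtain ⟨s, h⟩ := witt_one M hu v a ha hv
  obtain ⟨e, he⟩ := orth_equiv ℚ M v a (by simp) ha hv
  have hval : ∀ x : Fin n → ℤ, ∃ y : Fin n → ℚ,
      ((x ⬝ᵥ M *ᵥ x : ℤ) : ℚ) = ∑ i, (a i : ℚ) * (y i * y i) := by
    intro x
    refine ⟨e.symm (fun i => x i), ?_⟩
    rw [form_cast]
    have := he (e.symm (fun i => (x i : ℚ))) (e.symm (fun i => (x i : ℚ)))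
    rw [LinearEquiv.apply_symm_apply] at this
    rw [this]
    exact Finset.sum_congr rfl (fun i _ => by ring)
  obtain ⟨x, hx0, hx⟩ := diag_iso a ha (by
    by_contra hcon
    push Not at hcon
    obtain ⟨x, hx⟩ := hp
    obtain ⟨y, hy⟩ := hval x
    have : ∑ i, (a i : ℚ) * (y i * y i) ≤ 0 := Finset.sum_nonpos (fun i _ =>
      mul_nonpos_of_nonpos_of_nonneg (by exact_mod_cast hcon i) (mul_self_nonneg _))
    rw [← hy] at this
    have : x ⬝ᵥ M *ᵥ x ≤ 0 := by exact_mod_cast this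
    omega) (by
    by_contra hcon
    push Not at hcon
    obtain ⟨x, hx⟩ := hn
    obtain ⟨y, hy⟩ := hval x
    have : 0 ≤ ∑ i, (a i : ℚ) * (y i * y i) := Finset.sum_nonneg (fun i _ =>
      mul_nonneg (by exact_mod_cast hcon i) (mul_self_nonneg _))
    rw [← hy] at this
    have : 0 ≤ x ⬝ᵥ M *ᵥ x := by exact_mod_cast this
    omega) s h
  obtain ⟨d, z, hd, hz⟩ := clear_den (e x)
  have hd' : (d : ℚ) ≠ 0 := by exact_mod_cast hd
  have hzx : (fun i => (z i : ℚ)) = (d : ℚ) • e x := by ext i; simp [hz]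
  refine ⟨z, ?_, ?_⟩
  · rintro rfl
    have : (d : ℚ) • e x = 0 := by rw [← hzx]; ext i; simp
    rcases smul_eq_zero.mp this with h | h
    · exact hd' h
    · exact hx0 (e.map_eq_zero_iff.mp h)
  · have : ((z ⬝ᵥ M *ᵥ z : ℤ) : ℚ) = 0 := by
      rw [form_cast, hzx, smul_dotProduct, mulVec_smul, dotProduct_smul, he, hx]; simp
    exact_mod_cast this

end IUL

namespace IUL
open Matrix Module

lemma isom_bij {V W : Type} [AddCommGroup V] [Module.Free ℤ V] [Module.Finite ℤ V]
    [AddCommGroup W] [Module.Free ℤ W] [Module.Finite ℤ W]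
    (B : V →ₗ[ℤ] V →ₗ[ℤ] ℤ) (C : W →ₗ[ℤ] W →ₗ[ℤ] ℤ)
    (hB : Function.Bijective B) (f : V →ₗ[ℤ] W)
    (hf : ∀ x y, C (f x) (f y) = B x y) (hr : finrank ℤ V = finrank ℤ W) :
    Function.Bijective f := by
  have hin : ∀ x, (∀ y, B x y = 0) → x = 0 := by
    intro x hx
    apply hB.1
    rw [map_zero]; ext y; exact hx y
  have hinj : Function.Injective f := by
    rw [← LinearMap.ker_eq_bot, LinearMap.ker_eq_bot']
    intro x hx
    apply hin
    intro y
    rw [← hf, hx]; simp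
  refine ⟨hinj, fun w => ?_⟩
  obtain ⟨v, hv⟩ := hB.2 ((C w) ∘ₗ f)
  have hperp : ∀ y, C (w - f v) (f y) = 0 := by
    intro y
    have := LinearMap.congr_fun hv y
    rw [LinearMap.comp_apply] at this
    rw [map_sub, LinearMap.sub_apply, hf, this, sub_self]
  by_contra hcon
  push Not at hcon
  have hw : w - f v ≠ 0 := fun h => hcon v (sub_eq_zero.mp h).symm
  let g : V × ℤ →ₗ[ℤ] W := f.coprod (LinearMap.toSpanSingleton ℤ W (w - f v))
  have hg : Function.Injective g := by
    rw [← LinearMap.ker_eq_bot, LinearMap.ker_eq_bot']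
    rintro ⟨x, t⟩ hx
    have hx : f x + t • (w - f v) = 0 := hx
    have hx0 : x = 0 := by
      apply hin
      intro y
      have := congrArg (fun z => C z (f y)) hx
      simp only [map_add, map_smul, LinearMap.add_apply, LinearMap.smul_apply, hperp, hf] at this
      simpa using this
    subst hx0
    rw [map_zero, zero_add, smul_eq_zero] at hx
    rcases hx with h | h
    · rw [h]; rfl
    · exact absurd h hw
  have := LinearMap.finrank_le_finrank_of_injective hg
  rw [finrank_prod, finrank_self] at this
  omega

lemma gram_det {V : Type} [AddCommGroup V] [Module.Free ℤ V] [Module.Finite ℤ V]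
    (B : V →ₗ[ℤ] V →ₗ[ℤ] ℤ) (hB : Function.Bijective B) {n : ℕ} (b : Basis (Fin n) ℤ V) :
    (Matrix.of fun i j => B (b i) (b j)).det = 1 ∨ (Matrix.of fun i j => B (b i) (b j)).det = -1 := by
  have h := LinearEquiv.isUnit_det (LinearEquiv.ofBijective B hB) b b.dualBasis
  have e : (LinearMap.toMatrix b b.dualBasis (LinearEquiv.ofBijective B hB : V →ₗ[ℤ] _)) =
      (Matrix.of fun i j => B (b i) (b j))ᵀ := by
    ext i j
    rw [LinearMap.toMatrix_apply]
    simp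
  rw [e, det_transpose] at h
  exact Int.isUnit_iff.mp h

lemma gram_form {V : Type} [AddCommGroup V]
    (B : V →ₗ[ℤ] V →ₗ[ℤ] ℤ) {n : ℕ} (b : Basis (Fin n) ℤ V) (x y : Fin n → ℤ) :
    x ⬝ᵥ (Matrix.of fun i j => B (b i) (b j)) *ᵥ y =
      B (b.equivFun.symm x) (b.equivFun.symm y) := by
  simp only [dotProduct, mulVec, Basis.equivFun_symm_apply, map_sum, map_smul, LinearMap.sum_apply,
    LinearMap.smul_apply, Matrix.of_apply, smul_eq_mul, Finset.mul_sum]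
  rw [Finset.sum_comm]
  exact Finset.sum_congr rfl (fun i _ => Finset.sum_congr rfl (fun j _ => by ring))

lemma isotropy_abs {V : Type} [AddCommGroup V] [Module.Free ℤ V] [Module.Finite ℤ V]
    (B : V →ₗ[ℤ] V →ₗ[ℤ] ℤ) (hs : ∀ x y, B x y = B y x) (hB : Function.Bijective B)
    (hp : ∃ x, 0 < B x x) (hn : ∃ x, B x x < 0) : ∃ z, z ≠ 0 ∧ B z z = 0 := by
  let b := Module.finBasis ℤ V
  obtain ⟨z, hz, h⟩ := isotropy (Matrix.of fun i j => B (b i) (b j))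
    (by ext i j; simp [hs (b j) (b i)]) (gram_det B hB b)
    (by
      obtain ⟨x, hx⟩ := hp
      exact ⟨b.equivFun x, by rw [gram_form]; simpa using hx⟩)
    (by
      obtain ⟨x, hx⟩ := hn
      exact ⟨b.equivFun x, by rw [gram_form]; simpa using hx⟩)
  rw [gram_form] at h
  exact ⟨_, fun h0 => hz (b.equivFun.symm.map_eq_zero_iff.mp h0), h⟩

lemma hyp_pair {V : Type} [AddCommGroup V] [Module.Free ℤ V] [Module.Finite ℤ V]
    (B : V →ₗ[ℤ] V →ₗ[ℤ] ℤ) (hs : ∀ x y, B x y = B y x) (hB : Function.Bijective B)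
    (hp : ∃ x, 0 < B x x) (hn : ∃ x, B x x < 0) : ∃ x y, B x x = 0 ∧ B x y = 1 := by
  obtain ⟨z, hz0, hz⟩ := isotropy_abs B hs hB hp hn
  obtain ⟨d, hd⟩ := (IsPrincipalIdealRing.principal (LinearMap.range (B z) : Ideal ℤ)).principal
  have hmem : d ∈ LinearMap.range (B z) := by
    rw [hd]; exact Submodule.mem_span_singleton_self d
  obtain ⟨w, hw⟩ := hmem
  have hdvd : ∀ v, d ∣ B z v := by
    intro v
    have : B z v ∈ LinearMap.range (B z) := ⟨v, rfl⟩
    rw [hd] at this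
    exact Ideal.mem_span_singleton.mp this
  have hd0 : d ≠ 0 := by
    rintro rfl
    apply hz0
    apply hB.1
    rw [map_zero]; ext v
    exact zero_dvd_iff.mp (hdvd v)
  choose f hf using hdvd
  let F : V →ₗ[ℤ] ℤ :=
    { toFun := f
      map_add' := by
        intro x y
        apply mul_left_cancel₀ hd0
        rw [← hf, map_add, mul_add, ← hf, ← hf]
      map_smul' := by
        intro t y
        apply mul_left_cancel₀ hd0
        rw [← hf, map_smul, hf]; simp; ring }
  obtain ⟨x, hx⟩ := hB.2 F
  have hzx : z = d • x := by
    apply hB.1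
    ext v
    rw [map_smul, hx, hf]; rfl
  refine ⟨x, w, ?_, ?_⟩
  · rw [hzx] at hz
    simp only [map_smul, LinearMap.smul_apply, smul_eq_mul] at hz
    simpa [hd0] using hz
  · apply mul_left_cancel₀ hd0
    rw [hx]
    show d * f w = d * 1
    rw [← hf, hw, mul_one]

/-- has an orthonormal (up to sign) family of full rank -/
def Dia {V : Type} [AddCommGroup V] (B : V →ₗ[ℤ] V →ₗ[ℤ] ℤ) : Prop :=
  ∃ (ι : Type) (_ : Fintype ι) (_ : DecidableEq ι) (v : ι → V) (ε : ι → ℤ),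
    Fintype.card ι = finrank ℤ V ∧ (∀ i, ε i = 1 ∨ ε i = -1) ∧
      ∀ i j, B (v i) (v j) = if i = j then ε i else 0

/-- restriction of a form to the orthogonal complement of a vector -/
def res {V : Type} [AddCommGroup V] (B : V →ₗ[ℤ] V →ₗ[ℤ] ℤ) (e : V) :
    LinearMap.ker (B e) →ₗ[ℤ] LinearMap.ker (B e) →ₗ[ℤ] ℤ :=
  B.compl₁₂ (LinearMap.ker (B e)).subtype (LinearMap.ker (B e)).subtype

lemma res_app {V : Type} [AddCommGroup V] (B : V →ₗ[ℤ] V →ₗ[ℤ] ℤ) (e : V)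
    (x y : LinearMap.ker (B e)) : res B e x y = B x y := rfl

lemma res_bij {V : Type} [AddCommGroup V]
    (B : V →ₗ[ℤ] V →ₗ[ℤ] ℤ) (hs : ∀ x y, B x y = B y x) (hB : Function.Bijective B)
    (e : V) (he : B e e = 1 ∨ B e e = -1) : Function.Bijective (res B e) := by
  have hee : B e e * B e e = 1 := by rcases he with h | h <;> rw [h] <;> norm_num
  let π0 : V →ₗ[ℤ] V := LinearMap.id - (B e e) • (B e).smulRight e
  have hπ0 : ∀ v, π0 v = v - (B e e * B e v) • e := by
    intro v; simp [π0, mul_smul, smul_comm (B e v)]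
  let π : V →ₗ[ℤ] LinearMap.ker (B e) := LinearMap.codRestrict _ π0 (by
    intro v
    rw [LinearMap.mem_ker, hπ0, map_sub, map_smul, smul_eq_mul]
    linear_combination (- B e v) * hee)
  have hπ : ∀ v, ((π v : LinearMap.ker (B e)) : V) = v - (B e e * B e v) • e := hπ0
  have hk : ∀ w : LinearMap.ker (B e), B e w = 0 := fun w => w.2
  have hBπ : ∀ (w : LinearMap.ker (B e)) v, B w (π v) = B w v := by
    intro w v
    rw [hπ, map_sub, map_smul, hs w e, hk]; simp
  constructor
  · rw [← LinearMap.ker_eq_bot, LinearMap.ker_eq_bot']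
    intro w hw
    apply Subtype.ext
    apply hB.1
    ext v
    rw [← hBπ, ← res_app, hw]; simp
  · intro f
    obtain ⟨u, hu⟩ := hB.2 (f ∘ₗ π)
    refine ⟨π u, ?_⟩
    ext w
    rw [res_app, hs, hBπ, hs, hu, LinearMap.comp_apply]
    congr 1
    apply Subtype.ext
    rw [hπ, hk]; simp

lemma res_rank {V : Type} [AddCommGroup V] [Module.Free ℤ V] [Module.Finite ℤ V]
    (B : V →ₗ[ℤ] V →ₗ[ℤ] ℤ) 
    (e : V) (he : B e e = 1 ∨ B e e = -1) : finrank ℤ (LinearMap.ker (B e)) + 1 = finrank ℤ V := by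
  have h := Submodule.finrank_quotient_add_finrank (LinearMap.ker (B e))
  have hr : Function.Surjective (B e) := by
    intro t
    refine ⟨(t * B e e) • e, ?_⟩
    rw [map_smul, smul_eq_mul, mul_assoc]
    rcases he with h | h <;> rw [h] <;> norm_num
  rw [((B e).quotKerEquivOfSurjective hr).finrank_eq, finrank_self] at h
  omega

lemma dia_ext {V : Type} [AddCommGroup V] [Module.Free ℤ V] [Module.Finite ℤ V]
    (B : V →ₗ[ℤ] V →ₗ[ℤ] ℤ) (hs : ∀ x y, B x y = B y x)
    (e : V) (he : B e e = 1 ∨ B e e = -1) (h : Dia (res B e)) : Dia B := by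
  obtain ⟨ι, _, _, v, ε, hc, hε, hv⟩ := h
  refine ⟨Option ι, inferInstance, inferInstance, fun o => o.elim e (fun i => (v i : V)),
    fun o => o.elim (B e e) ε, ?_, ?_, ?_⟩
  · rw [Fintype.card_option, hc, res_rank B e he]
  · rintro (_ | i)
    · exact he
    · exact hε i
  · have hk : ∀ w : LinearMap.ker (B e), B e w = 0 := fun w => w.2
    rintro (_ | i) (_ | j)
    · simp
    · simp
    · simp [hs _ e]
    · have := hv i j
      rw [res_app] at this
      simpa using this

theorem odd_diag (k : ℕ) : ∀ (V : Type) [AddCommGroup V] [Module.Free ℤ V] [Module.Finite ℤ V]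
    (B : V →ₗ[ℤ] V →ₗ[ℤ] ℤ), (∀ x y, B x y = B y x) → Function.Bijective B →
    (∃ x, 0 < B x x) → (∃ x, B x x < 0) → (∃ x, B x x % 2 = 1) → finrank ℤ V = k → Dia B := by
  induction k with
  | zero =>
    intro V _ _ _ B hs hB hp hn ho hk
    obtain ⟨x, hx⟩ := hp
    have := finrank_zero_iff.mp hk
    rw [Subsingleton.elim x 0] at hx
    simp at hx
  | succ k ih =>
    intro V _ _ _ B hs hB hp hn ho hk
    obtain ⟨x, y0, hx, hxy0⟩ := hyp_pair B hs hB hp hn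
    obtain ⟨t, ht⟩ := ho
    obtain ⟨y1, hxy1, hy1⟩ : ∃ y, B x y = 1 ∧ B y y % 2 = 1 := by
      by_cases h : B y0 y0 % 2 = 1
      · exact ⟨y0, hxy0, h⟩
      · refine ⟨t + (1 - B x t) • y0, ?_, ?_⟩
        · rw [map_add, map_smul, hxy0]; simp
        · obtain ⟨m, hm⟩ : ∃ m, B y0 y0 = 2 * m := ⟨B y0 y0 / 2, by omega⟩
          have : B (t + (1 - B x t) • y0) (t + (1 - B x t) • y0) =
              B t t + 2 * ((1 - B x t) * B t y0 + (1 - B x t) ^ 2 * m) := by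
            simp only [map_add, map_smul, LinearMap.add_apply, LinearMap.smul_apply, smul_eq_mul,
              hs y0 t, hm]
            ring
          rw [this]; omega
    obtain ⟨m, hm⟩ : ∃ m, B y1 y1 = 2 * m + 1 := ⟨B y1 y1 / 2, by omega⟩
    obtain ⟨y, hxy, hy⟩ : ∃ y, B x y = 1 ∧ B y y = 1 := by
      refine ⟨y1 - m • x, ?_, ?_⟩
      · simp [hxy1, hx]
      · simp only [map_sub, map_smul, LinearMap.sub_apply, LinearMap.smul_apply, smul_eq_mul,
          hs y1 x, hm, hx, hxy1]
        ring
    obtain ⟨z, hz⟩ : ∃ z, z = y - x := ⟨_, rfl⟩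
    have hyz : B y z = 0 := by simp [hz, hy, hs y x, hxy]
    have hzy : B z y = 0 := by rw [hs, hyz]
    have hzz : B z z = -1 := by
      simp only [hz, map_sub, LinearMap.sub_apply, hs y x, hxy, hy, hx]; norm_num
    have hsr : ∀ e : V, ∀ a b, res B e a b = res B e b a := fun e a b => hs _ _
    by_cases hw : ∃ w, B y w = 0 ∧ B z w = 0 ∧ B w w ≠ 0
    · obtain ⟨w, hyw, hzw, hww⟩ := hw
      rcases lt_or_gt_of_ne hww with h | h
      · have hr := res_rank B z (Or.inr hzz)
        exact dia_ext B hs z (Or.inr hzz) (ih (LinearMap.ker (B z)) (res B z) (hsr z)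
          (res_bij B hs hB z (Or.inr hzz)) ⟨⟨y, hzy⟩, by rw [res_app]; simp [hy]⟩
          ⟨⟨w, hzw⟩, h⟩ ⟨⟨y, hzy⟩, by rw [res_app]; simp [hy]⟩ (by omega))
      · have hr := res_rank B y (Or.inl hy)
        exact dia_ext B hs y (Or.inl hy) (ih (LinearMap.ker (B y)) (res B y) (hsr y)
          (res_bij B hs hB y (Or.inl hy)) ⟨⟨w, hyw⟩, h⟩
          ⟨⟨z, hyz⟩, by rw [res_app]; simp [hzz]⟩ ⟨⟨z, hyz⟩, by rw [res_app]; simp [hzz]⟩ (by omega))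
    · push Not at hw
      apply dia_ext B hs y (Or.inl hy)
      let z' : LinearMap.ker (B y) := ⟨z, hyz⟩
      have hz' : res B y z' z' = 1 ∨ res B y z' z' = -1 := Or.inr hzz
      apply dia_ext (res B y) (hsr y) z' hz'
      have hbij := res_bij (res B y) (hsr y) (res_bij B hs hB y (Or.inl hy)) z' hz'
      have h0 : ∀ a : LinearMap.ker (res B y z'), res (res B y) z' a a = 0 :=
        fun a => hw _ a.1.2 a.2
      have h1 : ∀ a : LinearMap.ker (res B y z'), a = 0 := by
        intro a
        apply hbij.1
        rw [map_zero]
        ext b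
        have h2 := h0 (a + b)
        simp only [map_add, LinearMap.add_apply, h0] at h2
        have h3 : res (res B y) z' b a = res (res B y) z' a b := hs _ _
        rw [h3] at h2
        rw [LinearMap.zero_apply]
        linarith
      refine ⟨Empty, inferInstance, inferInstance, Empty.elim, Empty.elim, ?_, ?_, ?_⟩
      · have : Subsingleton (LinearMap.ker (res B y z')) := ⟨fun a b => by rw [h1 a, h1 b]⟩
        rw [finrank_zero_of_subsingleton]; rfl
      · rintro ⟨⟩
      · rintro ⟨⟩

lemma fam_iso {V : Type} [AddCommGroup V] [Module.Free ℤ V] [Module.Finite ℤ V]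
    (B : V →ₗ[ℤ] V →ₗ[ℤ] ℤ)
    {ι : Type} [Fintype ι] [DecidableEq ι] (v : ι → V) (ε : ι → ℤ)
    (hc : Fintype.card ι = finrank ℤ V) (hε : ∀ i, ε i = 1 ∨ ε i = -1)
    (hv : ∀ i j, B (v i) (v j) = if i = j then ε i else 0) :
    ∃ e : (ι → ℤ) ≃ₗ[ℤ] V, ∀ x y, B (e x) (e y) = ∑ i, ε i * x i * y i := by
  let D : (ι → ℤ) →ₗ[ℤ] (ι → ℤ) →ₗ[ℤ] ℤ := LinearMap.mk₂ ℤ (fun x y => ∑ i, ε i * x i * y i)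
    (fun x x' y => by rw [← Finset.sum_add_distrib]; exact Finset.sum_congr rfl (fun i _ => by simp; ring))
    (fun t x y => by rw [smul_eq_mul, Finset.mul_sum]; exact Finset.sum_congr rfl (fun i _ => by simp; ring))
    (fun x y y' => by rw [← Finset.sum_add_distrib]; exact Finset.sum_congr rfl (fun i _ => by simp; ring))
    (fun t x y => by rw [smul_eq_mul, Finset.mul_sum]; exact Finset.sum_congr rfl (fun i _ => by simp; ring))
  have hD : ∀ x y, D x y = ∑ i, ε i * x i * y i := fun x y => rfl
  have hDs : ∀ x i, D x (Pi.single i 1) = ε i * x i := by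
    intro x i
    rw [hD, Finset.sum_eq_single i]
    · simp
    · intro j _ hj; simp [hj]
    · simp
  have hεε : ∀ i, ε i * ε i = 1 := fun i => by rcases hε i with h | h <;> rw [h] <;> norm_num
  have hDb : Function.Bijective D := by
    constructor
    · intro x x' h
      ext i
      have h2 := LinearMap.congr_fun h (Pi.single i 1)
      rw [hDs, hDs] at h2
      linear_combination (ε i) * h2 - (x i - x' i) * hεε i
    · intro f
      refine ⟨fun i => ε i * f (Pi.single i 1), ?_⟩
      apply LinearMap.pi_ext'
      intro i
      ext
      simp only [LinearMap.comp_apply, LinearMap.single_apply]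
      rw [hDs, ← mul_assoc, hεε, one_mul]
  let f : (ι → ℤ) →ₗ[ℤ] V := Fintype.linearCombination ℤ v
  have hf0 : ∀ x, f x = ∑ i, x i • v i := fun x => rfl
  have hf : ∀ x y, B (f x) (f y) = D x y := by
    intro x y
    rw [hf0, hf0, hD, map_sum B, LinearMap.sum_apply]
    refine Finset.sum_congr rfl (fun i _ => ?_)
    rw [map_sum, Finset.sum_eq_single i]
    · simp [hv]; ring
    · intro j _ hj; simp [hv, hj.symm]
    · simp
  have hbij := isom_bij D B hDb f hf (by rw [finrank_fintype_fun_eq_card, hc])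
  exact ⟨LinearEquiv.ofBijective f hbij, fun x y => hf x y⟩

end IUL

namespace IUL
open Matrix Module

/-- modified form -/
def Bp {V : Type} [AddCommGroup V] (B : V →ₗ[ℤ] V →ₗ[ℤ] ℤ) (x : V) : V →ₗ[ℤ] V →ₗ[ℤ] ℤ :=
  B + (B x).smulRight (B x)

lemma Bp_app {V : Type} [AddCommGroup V] (B : V →ₗ[ℤ] V →ₗ[ℤ] ℤ) (x v w : V) :
    Bp B x v w = B v w + B x v * B x w := by
  simp [Bp]

lemma Bp_bij {V : Type} [AddCommGroup V] (B : V →ₗ[ℤ] V →ₗ[ℤ] ℤ) (hB : Function.Bijective B)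
    (x : V) (hx : B x x = 0) : Function.Bijective (Bp B x) := by
  have h : ∀ v, Bp B x v = B (v + B x v • x) := by
    intro v; ext w; rw [Bp_app]; simp
  constructor
  · intro v w hvw
    rw [h, h] at hvw
    have h1 := hB.1 hvw
    have h2 := congrArg (B x) h1
    simp only [map_add, map_smul, hx, smul_zero, add_zero] at h2
    rw [h2] at h1
    exact add_right_cancel h1
  · intro f
    obtain ⟨v, rfl⟩ := hB.2 f
    refine ⟨v - B x v • x, ?_⟩
    rw [h]
    simp [hx]

lemma Bp_symm {V : Type} [AddCommGroup V] (B : V →ₗ[ℤ] V →ₗ[ℤ] ℤ) (hs : ∀ x y, B x y = B y x)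
    (x : V) : ∀ v w, Bp B x v w = Bp B x w v := by
  intro v w; rw [Bp_app, Bp_app, hs v w]; ring

lemma Bp_par {V : Type} [AddCommGroup V] (B : V →ₗ[ℤ] V →ₗ[ℤ] ℤ) (he : ∀ v, B v v % 2 = 0)
    (x v : V) : Bp B x v v % 2 = B x v % 2 := by
  rw [Bp_app]
  have := he v
  rcases Int.emod_two_eq_zero_or_one (B x v) with h | h <;> simp [Int.add_emod, Int.mul_emod, h, this]

lemma even_core {V W : Type} [AddCommGroup V] [AddCommGroup W]
    (B : V →ₗ[ℤ] V →ₗ[ℤ] ℤ) (C : W →ₗ[ℤ] W →ₗ[ℤ] ℤ)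
    (hsC : ∀ x y, C x y = C y x)
    (heB : ∀ v, B v v % 2 = 0) (heC : ∀ v, C v v % 2 = 0)
    (x : V) (x' : W) (hx : B x x = 0) (hx' : C x' x' = 0)
    (φ : V →ₗ[ℤ] W) (hφ : ∀ v w, Bp C x' (φ v) (φ w) = Bp B x v w)
    (w : W) (k : ℤ) (hw : φ x = x' + (2 : ℤ) • w) (hk : C x' w = 2 * k) :
    ∃ ψ : V →ₗ[ℤ] W, ∀ u v, C (ψ u) (ψ v) = B u v := by
  have hpar : ∀ v, ∃ g, C x' (φ v) - B x v = 2 * g := by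
    intro v
    have h1 := Bp_par B heB x v
    have h2 := Bp_par C heC x' (φ v)
    rw [hφ] at h2
    exact ⟨(C x' (φ v) - B x v) / 2, by omega⟩
  choose g hg using hpar
  let G : V →ₗ[ℤ] ℤ :=
    { toFun := g
      map_add' := by
        intro u v
        have h1 := hg u
        have h2 := hg v
        have h3 := hg (u + v)
        simp only [map_add] at h3
        linarith
      map_smul' := by
        intro t v
        have h1 := hg v
        have h3 := hg (t • v)
        simp only [map_smul, smul_eq_mul] at h3
        apply mul_left_cancel₀ (two_ne_zero' ℤ)
        rw [← h3]
        simp only [RingHom.id_apply, smul_eq_mul]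
        linear_combination t * h1 }
  have hG : ∀ v, 2 * G v = C x' (φ v) - B x v := fun v => (hg v).symm
  let ψ : V →ₗ[ℤ] W := φ - (B x).smulRight w + (G - k • B x).smulRight x'
  have hψ : ∀ v, ψ v = φ v - B x v • w + (G v - k * B x v) • x' := fun v => by simp [ψ]
  refine ⟨ψ, fun u v => ?_⟩
  have huv := hφ u v
  have hu := hφ x u
  have hv := hφ x v
  have hxx := hφ x x
  rw [Bp_app, Bp_app] at huv hu hv hxx
  rw [hw] at hu hv hxx
  have h1 := hG u
  have h2 := hG v
  rw [hψ, hψ]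
  simp only [map_add, map_sub, map_smul, LinearMap.add_apply, LinearMap.sub_apply,
    LinearMap.smul_apply, smul_eq_mul, hx, hx', hk, hsC w x', hsC (φ u) w, hsC (φ u) x'] at *
  have hww : C w w = -2 * k - 4 * k ^ 2 := by linarith
  generalize C w (φ u) = wu at *
  generalize C w (φ v) = wv at *
  generalize C x' (φ u) = βu at *
  generalize C x' (φ v) = βv at *
  generalize C (φ u) (φ v) = c at *
  generalize B x u = αu at *
  generalize B x v = αv at *
  generalize G u = gu at *
  generalize G v = gv at *
  rw [hww]
  obtain rfl : βu = 2 * gu + αu := by linarith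
  obtain rfl : βv = 2 * gv + αv := by linarith
  have e1 : wu = - gu - 2 * k * (2 * gu + αu) := by linarith
  have e2 : wv = - gv - 2 * k * (2 * gv + αv) := by linarith
  rw [e1, e2]
  linear_combination huv

lemma even_glue {V W : Type} [AddCommGroup V] [AddCommGroup W]
    [Module.Free ℤ V] [Module.Finite ℤ V] [Module.Free ℤ W] [Module.Finite ℤ W]
    (B : V →ₗ[ℤ] V →ₗ[ℤ] ℤ) (C : W →ₗ[ℤ] W →ₗ[ℤ] ℤ)
    (hB : Function.Bijective B) (hC : Function.Bijective C)
    (hsC : ∀ x y, C x y = C y x)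
    (heB : ∀ v, B v v % 2 = 0) (heC : ∀ v, C v v % 2 = 0)
    (x : V) (x' y' : W) (hx : B x x = 0) (hx' : C x' x' = 0) (hxy' : C x' y' = 1)
    (hy' : C y' y' = 0)
    (φ : V ≃ₗ[ℤ] W) (hφ : ∀ v w, Bp C x' (φ v) (φ w) = Bp B x v w) :
    ∃ ψ : V ≃ₗ[ℤ] W, ∀ u v, C (ψ u) (ψ v) = B u v := by
  suffices h : ∃ ψ : V →ₗ[ℤ] W, ∀ u v, C (ψ u) (ψ v) = B u v by
    obtain ⟨ψ, hψ⟩ := h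
    exact ⟨LinearEquiv.ofBijective ψ (isom_bij B C hB ψ hψ φ.finrank_eq), hψ⟩
  have hbij := Bp_bij C hC x' hx'
  have hchar : ∀ v, ∃ g, Bp C x' (φ x - x') v = 2 * g := by
    intro v
    have h1 := hφ x (φ.symm v)
    have h2 := hφ (φ.symm v) (φ.symm v)
    rw [LinearEquiv.apply_symm_apply] at h1 h2
    have h3 := Bp_par B heB x (φ.symm v)
    have h4 := Bp_par C heC x' v
    have h5 : Bp B x x (φ.symm v) = B x (φ.symm v) := by rw [Bp_app, hx]; simp
    have h6 : Bp C x' x' v = C x' v := by rw [Bp_app, hx']; simp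
    rw [map_sub, LinearMap.sub_apply]
    exact ⟨(Bp C x' (φ x) v - Bp C x' x' v) / 2, by omega⟩
  choose g hg using hchar
  let G : W →ₗ[ℤ] ℤ :=
    { toFun := g
      map_add' := by
        intro u v
        have h1 := hg u
        have h2 := hg v
        have h3 := hg (u + v)
        rw [map_add] at h3
        linarith
      map_smul' := by
        intro t v
        have h1 := hg v
        have h3 := hg (t • v)
        rw [map_smul, smul_eq_mul] at h3
        apply mul_left_cancel₀ (two_ne_zero' ℤ)
        rw [← h3]
        simp only [RingHom.id_apply, smul_eq_mul]
        linear_combination t * h1 }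
  obtain ⟨w, hw⟩ := hbij.2 G
  have hxw : φ x = x' + (2 : ℤ) • w := by
    rw [← sub_eq_iff_eq_add']
    apply hbij.1
    ext v
    rw [hg, map_smul, hw]; rfl
  by_cases hpar : C x' w % 2 = 0
  · exact even_core B C hsC heB heC x x' hx hx' φ hφ w (C x' w / 2) hxw (by omega)
  · -- reflect
    let r : W →ₗ[ℤ] W := LinearMap.id - (Bp C x' y').smulRight ((2 : ℤ) • y')
    have hr : ∀ v, r v = v - (2 * Bp C x' y' v) • y' := fun v => by
      show v - Bp C x' y' v • ((2 : ℤ) • y') = _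
      rw [smul_smul, mul_comm]
    have hyy : Bp C x' y' y' = 1 := by rw [Bp_app, hy', hxy']; norm_num
    have hsp := Bp_symm C hsC x'
    have hri : ∀ u v, Bp C x' (r u) (r v) = Bp C x' u v := by
      intro u v
      simp only [hr, map_sub, map_smul, LinearMap.sub_apply, LinearMap.smul_apply, smul_eq_mul,
        hsp u y', hyy]
      ring
    refine even_core B C hsC heB heC x x' hx hx' (r ∘ₗ φ.toLinearMap) ?_
      (r w - y') (C x' (r w - y') / 2) ?_ ?_
    · intro u v
      simp only [LinearMap.comp_apply, LinearEquiv.coe_coe]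
      rw [hri, hφ]
    · simp only [LinearMap.comp_apply, LinearEquiv.coe_coe]
      rw [hxw, map_add, map_smul, hr x']
      have : Bp C x' y' x' = 1 := by rw [Bp_app, hsC y' x', hxy', hx']; norm_num
      rw [this]
      module
    · rw [hr, map_sub, map_sub, map_smul, hxy', smul_eq_mul]
      omega

/-- an even indefinite unimodular lattice -/
lemma even_data {V : Type} [AddCommGroup V] [Module.Free ℤ V] [Module.Finite ℤ V]
    (B : V →ₗ[ℤ] V →ₗ[ℤ] ℤ) (hs : ∀ x y, B x y = B y x) (hB : Function.Bijective B)
    (hp : ∃ x, 0 < B x x) (hn : ∃ x, B x x < 0) (he : ∀ v, B v v % 2 = 0) :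
    ∃ x y, B x x = 0 ∧ B x y = 1 ∧ B y y = 0 ∧ Dia (Bp B x) := by
  obtain ⟨x, y0, hx, hxy0⟩ := hyp_pair B hs hB hp hn
  obtain ⟨m, hm⟩ : ∃ m, B y0 y0 = 2 * m := ⟨B y0 y0 / 2, by have := he y0; omega⟩
  obtain ⟨y, hxy, hy⟩ : ∃ y, B x y = 1 ∧ B y y = 0 := by
    refine ⟨y0 - m • x, ?_, ?_⟩
    · simp [hxy0, hx]
    · simp only [map_sub, map_smul, LinearMap.sub_apply, LinearMap.smul_apply, smul_eq_mul,
        hs y0 x, hm, hx, hxy0]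
      ring
  refine ⟨x, y, hx, hxy, hy, ?_⟩
  have hyy : Bp B x y y = 1 := by rw [Bp_app, hy, hxy]; norm_num
  refine odd_diag _ V (Bp B x) (Bp_symm B hs x) (Bp_bij B hB x hx) ⟨y, by rw [hyy]; norm_num⟩
    ⟨y - x, ?_⟩ ⟨y, by rw [hyy]; norm_num⟩ rfl
  rw [Bp_app]
  simp only [map_sub, LinearMap.sub_apply, hs y x, hxy, hx, hy]
  norm_num

end IUL

namespace IUL
open Matrix Module

lemma idx {n : ℕ} {ι : Type} [Fintype ι] [DecidableEq ι]
    (M : Matrix (Fin n) (Fin n) ℤ) (v : ι → Fin n → ℤ) (a : ι → ℤ) (hc : Fintype.card ι = n)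
    (ha : ∀ i, a i ≠ 0) (hv : ∀ i j, v i ⬝ᵥ M *ᵥ v j = if i = j then a i else 0)
    (σ : ℤ) :
    sSup {k | ∃ H : Submodule ℝ (Fin n → ℝ), Module.finrank ℝ H = k ∧
      ∀ x ∈ H, x ≠ 0 → 0 < (σ : ℝ) * realForm M x x} = Fintype.card {i // 0 < σ * a i} := by
  obtain ⟨e, he⟩ := orth_equiv ℝ M v a hc ha hv
  have hq : ∀ x, (σ : ℝ) * realForm M (e x) (e x) = ∑ i, ((σ * a i : ℤ) : ℝ) * x i ^ 2 := by
    intro x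
    rw [realForm, he, Finset.mul_sum]
    exact Finset.sum_congr rfl (fun i _ => by push_cast; ring)
  apply IsGreatest.csSup_eq
  constructor
  · let E : ({i // 0 < σ * a i} → ℝ) →ₗ[ℝ] (ι → ℝ) :=
      Function.ExtendByZero.linearMap ℝ Subtype.val
    have hE : ∀ x i, E x i = if h : 0 < σ * a i then x ⟨i, h⟩ else 0 := by
      intro x i
      show Function.extend Subtype.val x 0 i = _
      split_ifs with h
      · exact Subtype.val_injective.extend_apply x 0 ⟨i, h⟩
      · rw [Function.extend_apply']
        · rfl
        · rintro ⟨j, rfl⟩; exact h j.2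
    have hinj : Function.Injective (e.toLinearMap ∘ₗ E) := by
      intro x y hxy
      have h1 : E x = E y := e.injective hxy
      ext i
      have := congrFun h1 i
      rw [hE, hE, dif_pos i.2, dif_pos i.2] at this
      exact this
    refine ⟨LinearMap.range (e.toLinearMap ∘ₗ E), ?_, ?_⟩
    · rw [LinearMap.finrank_range_of_inj hinj, finrank_fintype_fun_eq_card]
    · rintro _ ⟨x, rfl⟩ hx0
      simp only [LinearMap.comp_apply, LinearEquiv.coe_coe] at *
      rw [hq]
      have hnn : ∀ i ∈ Finset.univ, 0 ≤ ((σ * a i : ℤ) : ℝ) * E x i ^ 2 := by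
        intro i _
        by_cases h : 0 < σ * a i
        · have : (0 : ℝ) < ((σ * a i : ℤ) : ℝ) := by exact_mod_cast h
          positivity
        · rw [hE, dif_neg h]; simp
      refine lt_of_le_of_ne (Finset.sum_nonneg hnn) (fun h0 => hx0 ?_)
      have hz := (Finset.sum_eq_zero_iff_of_nonneg hnn).mp h0.symm
      have : E x = 0 := by
        ext i
        have h1 := hz i (Finset.mem_univ _)
        by_cases h : 0 < σ * a i
        · have : ((σ * a i : ℤ) : ℝ) ≠ 0 := by exact_mod_cast h.ne'
          rcases mul_eq_zero.mp h1 with h | h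
          · exact absurd h this
          · simpa using h
        · rw [hE, dif_neg h]; rfl
      rw [this, map_zero]
  · rintro k ⟨H, rfl, hH⟩
    let f : (Fin n → ℝ) →ₗ[ℝ] ({i // 0 < σ * a i} → ℝ) :=
      (LinearMap.funLeft ℝ ℝ Subtype.val) ∘ₗ e.symm.toLinearMap
    have hf : Function.Injective (f.domRestrict H) := by
      rw [← LinearMap.ker_eq_bot, LinearMap.ker_eq_bot']
      rintro ⟨x, hx⟩ hx0
      have hx1 : ∀ i, 0 < σ * a i → e.symm x i = 0 := fun i hi => congrFun hx0 ⟨i, hi⟩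
      apply Subtype.ext
      show x = 0
      by_contra hne
      have h1 := hH x hx hne
      have h2 := hq (e.symm x)
      rw [LinearEquiv.apply_symm_apply] at h2
      rw [h2] at h1
      refine absurd h1 (not_lt.mpr (Finset.sum_nonpos (fun i _ => ?_)))
      by_cases h : 0 < σ * a i
      · rw [hx1 i h]; simp
      · have : ((σ * a i : ℤ) : ℝ) ≤ 0 := by exact_mod_cast not_lt.mp h
        exact mul_nonpos_of_nonpos_of_nonneg this (sq_nonneg _)
    have := LinearMap.finrank_le_finrank_of_injective hf
    rwa [finrank_fintype_fun_eq_card] at this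

lemma posIndex_eq {n : ℕ} {ι : Type} [Fintype ι] [DecidableEq ι]
    (M : Matrix (Fin n) (Fin n) ℤ) (v : ι → Fin n → ℤ) (a : ι → ℤ) (hc : Fintype.card ι = n)
    (ha : ∀ i, a i ≠ 0) (hv : ∀ i j, v i ⬝ᵥ M *ᵥ v j = if i = j then a i else 0) :
    posIndex M = Fintype.card {i // 0 < a i} := by
  have := idx M v a hc ha hv 1
  simp only [Int.cast_one, one_mul] at this
  exact this

lemma negIndex_eq {n : ℕ} {ι : Type} [Fintype ι] [DecidableEq ι]
    (M : Matrix (Fin n) (Fin n) ℤ) (v : ι → Fin n → ℤ) (a : ι → ℤ) (hc : Fintype.card ι = n)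
    (ha : ∀ i, a i ≠ 0) (hv : ∀ i j, v i ⬝ᵥ M *ᵥ v j = if i = j then a i else 0) :
    negIndex M = Fintype.card {i // a i < 0} := by
  have := idx M v a hc ha hv (-1)
  simp only [Int.cast_neg, Int.cast_one, neg_mul, one_mul, Left.neg_pos_iff] at this
  exact this

/-- bilinear form of a matrix -/
noncomputable def bil {n : ℕ} (M : Matrix (Fin n) (Fin n) ℤ) :
    (Fin n → ℤ) →ₗ[ℤ] (Fin n → ℤ) →ₗ[ℤ] ℤ := Matrix.toBilin' M

lemma bil_app {n : ℕ} (M : Matrix (Fin n) (Fin n) ℤ) (x y : Fin n → ℤ) :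
    bil M x y = x ⬝ᵥ M *ᵥ y := Matrix.toBilin'_apply' M x y

lemma bil_symm {n : ℕ} (M : Matrix (Fin n) (Fin n) ℤ) (hs : M.IsSymm) (x y : Fin n → ℤ) :
    bil M x y = bil M y x := by
  rw [bil_app, bil_app, dotProduct_mulVec, ← mulVec_transpose, hs.eq, dotProduct_comm]

lemma bil_bij {n : ℕ} (M : Matrix (Fin n) (Fin n) ℤ) (hu : Unimodular M) :
    Function.Bijective (bil M) := by
  have hd : IsUnit M.det := Int.isUnit_iff.mpr hu
  have h : ∀ x i, bil M x (Pi.single i 1) = (x ᵥ* M) i := by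
    intro x i
    rw [bil_app, dotProduct_mulVec]; simp
  constructor
  · intro x y hxy
    have h1 : x ᵥ* M = y ᵥ* M := by ext i; rw [← h, ← h, hxy]
    have h2 := congrArg (fun z => z ᵥ* M⁻¹) h1
    simpa [vecMul_vecMul, mul_nonsing_inv M hd] using h2
  · intro f
    refine ⟨(fun i => f (Pi.single i 1)) ᵥ* M⁻¹, ?_⟩
    apply LinearMap.pi_ext'
    intro i
    ext
    simp only [LinearMap.comp_apply, LinearMap.single_apply]
    rw [h, vecMul_vecMul, nonsing_inv_mul M hd, vecMul_one]

lemma eps_match {ι κ : Type} [Fintype ι] [Fintype κ] (ε : ι → ℤ) (δ : κ → ℤ)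
    (hε : ∀ i, ε i = 1 ∨ ε i = -1) (hδ : ∀ i, δ i = 1 ∨ δ i = -1)
    (hc : Fintype.card ι = Fintype.card κ)
    (hp : Fintype.card {i // 0 < ε i} = Fintype.card {i // 0 < δ i}) :
    ∃ f : ι ≃ κ, ∀ i, δ (f i) = ε i := by
  classical
  have e1 : {i // 0 < ε i} ≃ {i // 0 < δ i} := Fintype.equivOfCardEq hp
  have e2 : {i // ¬ 0 < ε i} ≃ {i // ¬ 0 < δ i} := Fintype.equivOfCardEq (by
    rw [Fintype.card_subtype_compl, Fintype.card_subtype_compl, hc, hp])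
  refine ⟨(Equiv.sumCompl (fun i => 0 < ε i)).symm.trans
    ((Equiv.sumCongr e1 e2).trans (Equiv.sumCompl (fun i => 0 < δ i))), ?_⟩
  intro i
  obtain ⟨s, rfl⟩ := (Equiv.sumCompl (fun i => 0 < ε i)).surjective i
  simp only [Equiv.trans_apply, Equiv.symm_apply_apply]
  rcases s with ⟨i, h⟩ | ⟨i, h⟩
  · have h1 := (e1 ⟨i, h⟩).2
    have h2 := hδ (e1 ⟨i, h⟩)
    have h3 := hε i
    show δ (e1 ⟨i, h⟩ : κ) = ε i
    omega
  · have h1 := (e2 ⟨i, h⟩).2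
    have h2 := hδ (e2 ⟨i, h⟩)
    have h3 := hε i
    show δ (e2 ⟨i, h⟩ : κ) = ε i
    omega

lemma dia_isom {V W : Type} [AddCommGroup V] [AddCommGroup W]
    [Module.Free ℤ V] [Module.Finite ℤ V] [Module.Free ℤ W] [Module.Finite ℤ W]
    (B : V →ₗ[ℤ] V →ₗ[ℤ] ℤ) (C : W →ₗ[ℤ] W →ₗ[ℤ] ℤ)
    {ι κ : Type} [Fintype ι] [Fintype κ] [DecidableEq ι] [DecidableEq κ]
    (v : ι → V) (ε : ι → ℤ)
    (hc : Fintype.card ι = finrank ℤ V) (hε : ∀ i, ε i = 1 ∨ ε i = -1)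
    (hv : ∀ i j, B (v i) (v j) = if i = j then ε i else 0)
    (w : κ → W) (δ : κ → ℤ)
    (hc' : Fintype.card κ = finrank ℤ W) (hδ : ∀ i, δ i = 1 ∨ δ i = -1)
    (hw : ∀ i j, C (w i) (w j) = if i = j then δ i else 0)
    (hr : finrank ℤ V = finrank ℤ W)
    (hp : Fintype.card {i // 0 < ε i} = Fintype.card {i // 0 < δ i}) :
    ∃ e : V ≃ₗ[ℤ] W, ∀ x y, C (e x) (e y) = B x y := by
  obtain ⟨f, hf⟩ := eps_match ε δ hε hδ (by omega) hp
  obtain ⟨e1, h1⟩ := fam_iso B v ε hc hε hv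
  obtain ⟨e2, h2⟩ := fam_iso C (w ∘ f) ε (by omega) hε (by
    intro i j
    simp only [Function.comp_apply, hw, hf, EmbeddingLike.apply_eq_iff_eq])
  refine ⟨e1.symm.trans e2, fun x y => ?_⟩
  rw [LinearEquiv.trans_apply, LinearEquiv.trans_apply, h2, ← h1]
  simp

lemma eps_cards {n : ℕ} (M : Matrix (Fin n) (Fin n) ℤ) (hs : M.IsSymm) (hu : Unimodular M) :
    posIndex M + negIndex M = n := by
  obtain ⟨v, a, ha, hv⟩ := exists_orth M hs (by rcases hu with h | h <;> rw [h] <;> norm_num)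
  rw [posIndex_eq M v a (by simp) ha hv, negIndex_eq M v a (by simp) ha hv]
  have h := Fintype.card_subtype_compl (fun i => 0 < a i)
  have h2 : Fintype.card {i // ¬ 0 < a i} = Fintype.card {i // a i < 0} :=
    Fintype.card_congr (Equiv.subtypeEquivRight (fun i => by have := ha i; omega))
  have h3 := Fintype.card_subtype_le (fun i => 0 < a i)
  rw [Fintype.card_fin] at h h3
  omega

lemma indef_vec {n : ℕ} (M : Matrix (Fin n) (Fin n) ℤ) (hs : M.IsSymm) (hu : Unimodular M)
    (hi : Indefinite M) : (∃ x, 0 < bil M x x) ∧ ∃ x, bil M x x < 0 := by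
  obtain ⟨v, a, ha, hv⟩ := exists_orth M hs (by rcases hu with h | h <;> rw [h] <;> norm_num)
  obtain ⟨h1, h2⟩ := hi
  rw [posIndex_eq M v a (by simp) ha hv] at h1
  rw [negIndex_eq M v a (by simp) ha hv] at h2
  obtain ⟨i, hi⟩ := Fintype.card_pos_iff.mp h1
  obtain ⟨j, hj⟩ := Fintype.card_pos_iff.mp h2
  refine ⟨⟨v i, ?_⟩, ⟨v j, ?_⟩⟩
  · rw [bil_app, hv, if_pos rfl]; exact hi
  · rw [bil_app, hv, if_pos rfl]; exact hj

lemma odd_fam {n : ℕ} (M : Matrix (Fin n) (Fin n) ℤ) (hs : M.IsSymm) (hu : Unimodular M)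
    (hi : Indefinite M) (ho : ¬ IsEvenLattice M) :
    ∃ (ι : Type) (_ : Fintype ι) (_ : DecidableEq ι) (v : ι → Fin n → ℤ) (ε : ι → ℤ),
    Fintype.card ι = finrank ℤ (Fin n → ℤ) ∧ (∀ i, ε i = 1 ∨ ε i = -1) ∧
      (∀ i j, bil M (v i) (v j) = if i = j then ε i else 0) ∧
      posIndex M = Fintype.card {i // 0 < ε i} := by
  obtain ⟨hp, hn⟩ := indef_vec M hs hu hi
  have ho' : ∃ x, bil M x x % 2 = 1 := by
    by_contra hcon
    push Not at hcon
    apply ho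
    intro x
    have := hcon x
    rw [bil_app] at this
    rw [intForm]
    omega
  obtain ⟨ι, _, _, v, ε, hc, hε, hv⟩ := odd_diag _ _ (bil M) (bil_symm M hs) (bil_bij M hu) hp hn ho' rfl
  refine ⟨ι, _, _, v, ε, hc, hε, hv, ?_⟩
  exact posIndex_eq M v ε (by simpa using hc) (fun i => by rcases hε i with h | h <;> rw [h] <;> norm_num)
    (fun i j => by rw [← bil_app, hv])

lemma even_fam {n : ℕ} (M : Matrix (Fin n) (Fin n) ℤ) (hs : M.IsSymm) (hu : Unimodular M)
    (hi : Indefinite M) (he : IsEvenLattice M) :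
    ∃ (x y : Fin n → ℤ), bil M x x = 0 ∧ bil M x y = 1 ∧ bil M y y = 0 ∧
    ∃ (ι : Type) (_ : Fintype ι) (_ : DecidableEq ι) (v : ι → Fin n → ℤ) (ε : ι → ℤ),
    Fintype.card ι = finrank ℤ (Fin n → ℤ) ∧ (∀ i, ε i = 1 ∨ ε i = -1) ∧
      (∀ i j, Bp (bil M) x (v i) (v j) = if i = j then ε i else 0) ∧
      posIndex M = Fintype.card {i // 0 < ε i} := by
  obtain ⟨hp, hn⟩ := indef_vec M hs hu hi
  obtain ⟨x, y, hx, hxy, hy, ι, _, _, v, ε, hc, hε, hv⟩ := even_data (bil M) (bil_symm M hs)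
    (bil_bij M hu) hp hn (fun v => by
      have := he v
      rw [intForm, ← bil_app] at this
      omega)
  refine ⟨x, y, hx, hxy, hy, ι, _, _, v, ε, hc, hε, hv, ?_⟩
  have h := posIndex_eq M (fun i => (2 : ℤ) • v i + bil M x (v i) • x) (fun i => 4 * ε i)
    (by simpa using hc) (fun i => by rcases hε i with h | h <;> rw [h] <;> norm_num) (fun i j => by
      have h1 := hv i j
      rw [Bp_app] at h1
      rw [← bil_app]
      simp only [map_add, map_smul, LinearMap.add_apply, LinearMap.smul_apply, smul_eq_mul, hx,
        bil_symm M hs (v i) x]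
      split_ifs at h1 ⊢ <;> linear_combination 4 * h1)
  rw [h]
  exact Fintype.card_congr (Equiv.subtypeEquivRight (fun i => by omega))

theorem classification
    {n n' : ℕ}
    (M : Matrix (Fin n) (Fin n) ℤ) (M' : Matrix (Fin n') (Fin n') ℤ)
    (hs : M.IsSymm) (hs' : M'.IsSymm)
    (hu : Unimodular M) (hu' : Unimodular M')
    (hi : Indefinite M) (hi' : Indefinite M') :
    LatticeIso M M' ↔
      (n = n' ∧ signatureZ M = signatureZ M' ∧ (IsEvenLattice M ↔ IsEvenLattice M')) := by
  constructor
  · rintro ⟨e, he⟩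
    have hn : n = n' := by simpa using e.finrank_eq
    subst hn
    refine ⟨rfl, ?_, ?_⟩
    · obtain ⟨v, a, ha, hv⟩ := exists_orth M hs (by rcases hu with h | h <;> rw [h] <;> norm_num)
      have hv' : ∀ i j, e (v i) ⬝ᵥ M' *ᵥ e (v j) = if i = j then a i else 0 := by
        intro i j; rw [← hv]; exact he _ _
      rw [signatureZ, signatureZ, posIndex_eq M v a (by simp) ha hv,
        negIndex_eq M v a (by simp) ha hv, posIndex_eq M' (fun i => e (v i)) a (by simp) ha hv',
        negIndex_eq M' (fun i => e (v i)) a (by simp) ha hv']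
    · constructor
      · intro h x
        have := h (e.symm x)
        rwa [← he, e.apply_symm_apply] at this
      · intro h x
        have := h (e x)
        rwa [he] at this
  · rintro ⟨rfl, hsig, hev⟩
    have hpos : posIndex M = posIndex M' := by
      have h1 := eps_cards M hs hu
      have h2 := eps_cards M' hs' hu'
      rw [signatureZ, signatureZ] at hsig
      omega
    have hfin : ∀ e : (Fin n → ℤ) ≃ₗ[ℤ] (Fin n → ℤ), (∀ x y, bil M' (e x) (e y) = bil M x y) →
        LatticeIso M M' := fun e h => ⟨e, fun x y => by
          have := h x y
          rw [bil_app, bil_app] at this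
          exact this⟩
    by_cases he : IsEvenLattice M
    · have he' := hev.mp he
      obtain ⟨x, y, hx, hxy, hy, ι, _, _, v, ε, hc, hε, hv, hp⟩ := even_fam M hs hu hi he
      obtain ⟨x', y', hx', hxy', hy', κ, _, _, w, δ, hc', hδ, hw, hp'⟩ := even_fam M' hs' hu' hi' he'
      obtain ⟨φ, hφ⟩ := dia_isom _ _ v ε hc hε hv w δ hc' hδ hw rfl (by omega)
      have hpar : ∀ {N : Matrix (Fin n) (Fin n) ℤ}, IsEvenLattice N → ∀ v, bil N v v % 2 = 0 := by
        intro N hN v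
        have := hN v
        rw [intForm, ← bil_app] at this
        omega
      obtain ⟨ψ, hψ⟩ := even_glue (bil M) (bil M') (bil_bij M hu) (bil_bij M' hu') (bil_symm M' hs')
        (hpar he) (hpar he') x x' y' hx hx' hxy' hy' φ hφ
      exact hfin ψ hψ
    · obtain ⟨ι, _, _, v, ε, hc, hε, hv, hp⟩ := odd_fam M hs hu hi he
      obtain ⟨κ, _, _, w, δ, hc', hδ, hw, hp'⟩ := odd_fam M' hs' hu' hi' (fun h => he (hev.mpr h))
      obtain ⟨φ, hφ⟩ := dia_isom _ _ v ε hc hε hv w δ hc' hδ hw rfl (by omega)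
      exact hfin φ hφ

end IUL

theorem indefinite_unimodular_lattice_classification
    {n n' : ℕ}
    (M : Matrix (Fin n) (Fin n) ℤ) (M' : Matrix (Fin n') (Fin n') ℤ)
    (hs : M.IsSymm) (hs' : M'.IsSymm)
    (hu : Unimodular M) (hu' : Unimodular M')
    (hi : Indefinite M) (hi' : Indefinite M') :
    LatticeIso M M' ↔
      (n = n' ∧ signatureZ M = signatureZ M' ∧ (IsEvenLattice M ↔ IsEvenLattice M')) := by
  exact IUL.classification M M' hs hs' hu hu' hi hi'
end

section
/- For an even unimodular integral lattice B, the signature σ(B) is divisible by 8. -/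
/-!
STATEMENT 9: For an even unimodular integral lattice B, the signature σ(B) is
divisible by 8.

The lattice is realized as ℤ^n with a symmetric Gram matrix of determinant ±1;
evenness means all vectors have even square, and σ = b₊ − b₋ is the signature
of the induced real form.
-/

open Matrix

open Complex Filter Topology in
lemma ofReal_mul_cpow_half {r : ℝ} (hr : 0 < r) {x : ℂ} (hx : x ≠ 0) :
    ((r : ℂ) * x) ^ (1 / 2 : ℂ) = (Real.sqrt r : ℂ) * x ^ (1 / 2 : ℂ) := by
  have hr' : (r : ℂ) ≠ 0 := by exact_mod_cast hr.ne'
  rw [cpow_def_of_ne_zero (mul_ne_zero hr' hx), cpow_def_of_ne_zero hx, log_ofReal_mul hr hx,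
    add_mul, Complex.exp_add, Real.sqrt_eq_rpow, Complex.ofReal_cpow hr.le,
    cpow_def_of_ne_zero hr', Complex.ofReal_log hr.le]
  push_cast
  rfl

open Complex Filter Topology in
lemma theta_split (d N : ℕ) (hd : 0 < d) (hd2 : 2 ∣ d) (hN : 0 < N) (hdN : d ∣ N)
    (ε : ℝ) (hε : 0 < ε) :
    jacobiTheta (1 / d + I * ε) = ∑ r : Fin N, cexp (Real.pi * I * (r : ℕ) ^ 2 / d) *
      (HurwitzZeta.evenKernel (((r : ℕ) / N : ℝ) : UnitAddCircle) (N ^ 2 * ε) : ℂ) := by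
  have : NeZero N := ⟨hN.ne'⟩
  have him : 0 < (1 / d + I * ε : ℂ).im := by
    have : (1 / d + I * ε : ℂ) = ((1 / d : ℝ) : ℂ) + I * ε := by push_cast; rfl
    rw [this, add_im, ofReal_im]; simpa using hε
  have hs := hasSum_jacobiTheta₂_term 0 him
  rw [← jacobiTheta_eq_jacobiTheta₂] at hs
  have hs2 := ((Int.divModEquiv N).symm.trans (Equiv.refl _)).hasSum_iff.mpr hs
  have hs3 := ((Equiv.prodComm (Fin N) ℤ).hasSum_iff).mpr hs2
  refine (hs3.prod_fiberwise (g := fun r : Fin N => cexp (Real.pi * I * (r : ℕ) ^ 2 / d) *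
      (HurwitzZeta.evenKernel (((r : ℕ) / N : ℝ) : UnitAddCircle) (N ^ 2 * ε) : ℂ)) ?_).unique
      (hasSum_fintype _)
  intro r
  have hk := (Complex.hasSum_ofReal.mpr (HurwitzZeta.hasSum_int_evenKernel ((r : ℕ) / N : ℝ)
    (t := N ^ 2 * ε) (by positivity))).mul_left (cexp (Real.pi * I * (r : ℕ) ^ 2 / d))
  refine hk.congr_fun ?_
  intro m
  obtain ⟨a, rfl⟩ := hd2
  obtain ⟨b, rfl⟩ := hdN
  have ha : (a : ℂ) ≠ 0 := by rintro h; simp at h; simp [h] at hd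
  have hb : (b : ℂ) ≠ 0 := by rintro h; simp at h; simp [h] at hN
  simp only [Function.comp, jacobiTheta₂_term, Equiv.prodComm_apply, Prod.swap, Equiv.trans_apply, Int.divModEquiv_symm_apply, Equiv.refl_apply]
  push_cast
  rw [← Complex.exp_add, Complex.exp_eq_exp_iff_exists_int]
  refine ⟨m ^ 2 * a * b ^ 2 + m * b * (r : ℕ), ?_⟩
  push_cast
  field_simp
  ring_nf
  simp only [I_sq]
  ring

open Complex Filter Topology in
lemma kernel_lim (N : ℕ) (hN : 0 < N) (a : UnitAddCircle) :
    Tendsto (fun ε : ℝ => Real.sqrt ε * HurwitzZeta.evenKernel a (N ^ 2 * ε)) (𝓝[>] 0)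
      (𝓝 (1 / N)) := by
  have h1 : Tendsto (fun x => HurwitzZeta.cosKernel a x) atTop (𝓝 1) := by
    obtain ⟨p, hp, h⟩ := HurwitzZeta.isBigO_atTop_cosKernel_sub a
    have h2 : Tendsto (fun x : ℝ => Real.exp (-p * x)) atTop (𝓝 0) := by
      simp only [neg_mul]
      exact Real.tendsto_exp_neg_atTop_nhds_zero.comp (tendsto_id.const_mul_atTop hp)
    have := (h.trans_tendsto h2).add_const 1
    simpa using this
  have h3 : Tendsto (fun ε : ℝ => 1 / (N ^ 2 * ε)) (𝓝[>] 0) atTop := by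
    have := (tendsto_inv_nhdsGT_zero (𝕜 := ℝ)).const_mul_atTop (r := 1 / (N : ℝ) ^ 2) (by positivity)
    refine this.congr fun x => ?_
    rw [one_div, one_div, mul_inv]
  have h4 := (h1.comp h3).const_mul (1 / (N : ℝ))
  rw [mul_one] at h4
  refine h4.congr' ?_
  filter_upwards [self_mem_nhdsWithin] with ε hε
  have hε : 0 < ε := hε
  rw [HurwitzZeta.evenKernel_functional_equation, ← Real.sqrt_eq_rpow, Real.sqrt_mul (by positivity),
    Real.sqrt_sq (by positivity)]
  have : Real.sqrt ε ≠ 0 := (Real.sqrt_pos.mpr hε).ne'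
  simp only [Function.comp]
  field_simp

open Complex Filter Topology in
lemma theta_add_even (a : ℕ) (τ : ℂ) : jacobiTheta (τ + 2 * a) = jacobiTheta τ := by
  induction a with
  | zero => simp
  | succ k ih =>
    rw [← ih, ← jacobiTheta_two_add (τ + 2 * k)]
    congr 1; push_cast; ring

open Complex Filter Topology in
lemma theta_fe (τ : ℂ) : jacobiTheta τ = 1 / (-I * τ) ^ (1 / 2 : ℂ) * jacobiTheta (-1 / τ) := by
  rw [jacobiTheta_eq_jacobiTheta₂, jacobiTheta_eq_jacobiTheta₂, jacobiTheta₂_functional_equation]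
  simp

open Complex Filter Topology in
lemma theta_lim (d : ℕ) (hd : 0 < d) (hd2 : 2 ∣ d) :
    Tendsto (fun ε : ℝ => (Real.sqrt ε : ℂ) * jacobiTheta (1 / d + I * ε)) (𝓝[>] 0)
      (𝓝 (1 / (Real.sqrt d) * cexp (Real.pi * I / 4))) := by
  have hdc : (d : ℂ) ≠ 0 := by exact_mod_cast hd.ne'
  have hdr : (0 : ℝ) < d := by exact_mod_cast hd
  have h0 : ∀ ε : ℝ, (1 + I * d * ε : ℂ) ≠ 0 := by
    intro ε h
    have := congrArg re h
    simp at this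
  -- the identity
  have key : ∀ ε : ℝ, 0 < ε → (Real.sqrt ε : ℂ) * jacobiTheta (1 / d + I * ε) =
      1 / (-I * (1 / d + I * ε)) ^ (1 / 2 : ℂ) * (1 / (d * (1 / (1 + I * d * ε)) ^ (1 / 2 : ℂ))) *
        jacobiTheta (I * (1 / (d ^ 2 * ε) : ℝ) - 1 / d) := by
    intro ε hε
    have hεc : (ε : ℂ) ≠ 0 := by exact_mod_cast hε.ne'
    obtain ⟨a, ha⟩ := hd2
    have hτ : (1 / d + I * ε : ℂ) = (1 + I * d * ε) / d := by field_simp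
    have e1 : (-1 / (1 / d + I * ε) : ℂ) + 2 * a = I * d ^ 2 * ε / (1 + I * d * ε) := by
      have : (2 * a : ℂ) = d := by rw [ha]; push_cast; ring
      rw [this, hτ]
      have := h0 ε
      field_simp
      ring
    rw [theta_fe, ← theta_add_even a, e1, theta_fe (_ / _)]
    have e2 : -I * (I * d ^ 2 * ε / (1 + I * d * ε)) =
        ((d ^ 2 * ε : ℝ) : ℂ) * (1 / (1 + I * d * ε)) := by
      have := h0 ε
      push_cast
      field_simp
      rw [I_sq]; ring
    have e3 : -1 / (I * d ^ 2 * ε / (1 + I * d * ε)) = I * (1 / (d ^ 2 * ε) : ℝ) - 1 / d := by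
      have := h0 ε
      have hI := I_ne_zero
      push_cast
      field_simp
      ring_nf
      rw [I_sq]; ring
    rw [e2, e3, ofReal_mul_cpow_half (by positivity) (one_div_ne_zero (h0 ε)),
      Real.sqrt_mul (by positivity), Real.sqrt_sq (by positivity)]
    have : (Real.sqrt ε : ℂ) ≠ 0 := by exact_mod_cast (Real.sqrt_pos.mpr hε).ne'
    push_cast
    generalize hA : (1 / (1 + I * d * ε)) ^ (1 / 2 : ℂ) = A
    generalize hB : (-I * (1 / d + I * ε)) ^ (1 / 2 : ℂ) = B
    by_cases hA0 : A = 0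
    · simp [hA0]
    by_cases hB0 : B = 0
    · simp [hB0]
    field_simp
  -- limits
  have l1 : Tendsto (fun ε : ℝ => jacobiTheta (I * (1 / (d ^ 2 * ε) : ℝ) - 1 / d)) (𝓝[>] 0) (𝓝 1) := by
    have hb := isBigO_at_im_infty_jacobiTheta_sub_one
    have h2 : Tendsto (fun τ : ℂ => Real.exp (-Real.pi * τ.im)) (comap im atTop) (𝓝 0) := by
      simp only [neg_mul]
      exact Real.tendsto_exp_neg_atTop_nhds_zero.comp (tendsto_comap.const_mul_atTop Real.pi_pos)
    have h3 := (hb.trans_tendsto h2).add_const 1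
    simp only [sub_add_cancel, zero_add] at h3
    refine h3.comp ?_
    rw [tendsto_comap_iff]
    have := (tendsto_inv_nhdsGT_zero (𝕜 := ℝ)).const_mul_atTop (r := 1 / (d : ℝ) ^ 2) (by positivity)
    refine this.congr fun x => ?_
    have e : (1 / d : ℂ) = ((1 / d : ℝ) : ℂ) := by push_cast; rfl
    simp only [Function.comp]
    rw [e, sub_im, ofReal_im, I_mul_im, ofReal_re, one_div, one_div, mul_inv, sub_zero]
  have l2 : Tendsto (fun ε : ℝ => (-I * (1 / d + I * ε) : ℂ) ^ (1 / 2 : ℂ)) (𝓝[>] 0)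
      (𝓝 ((-I * (1 / d)) ^ (1 / 2 : ℂ))) := by
    have : ContinuousAt (fun ε : ℝ => (-I * (1 / d + I * ε) : ℂ) ^ (1 / 2 : ℂ)) 0 := by
      refine ContinuousAt.cpow (by fun_prop) (by fun_prop) ?_
      right
      have e : (1 / d : ℂ) = ((1 / d : ℝ) : ℂ) := by push_cast; rfl
      rw [e]
      simp [hd.ne']
    have := this.tendsto.mono_left (nhdsWithin_le_nhds (s := Set.Ioi 0))
    simpa using this
  have l3 : Tendsto (fun ε : ℝ => (1 / (1 + I * d * ε) : ℂ) ^ (1 / 2 : ℂ)) (𝓝[>] 0) (𝓝 1) := by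
    have : ContinuousAt (fun ε : ℝ => (1 / (1 + I * d * ε) : ℂ) ^ (1 / 2 : ℂ)) 0 := by
      refine ContinuousAt.cpow ?_ (by fun_prop) ?_
      · exact ContinuousAt.div (by fun_prop) (by fun_prop) (h0 0)
      · left; simp
    have := this.tendsto.mono_left (nhdsWithin_le_nhds (s := Set.Ioi 0))
    simpa using this
  have e4 : (-I * (1 / d) : ℂ) ^ (1 / 2 : ℂ) = 1 / Real.sqrt d * cexp (-(Real.pi * I / 4)) := by
    have : (-I * (1 / d) : ℂ) = ((1 / d : ℝ) : ℂ) * (-I) := by push_cast; ring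
    rw [this, ofReal_mul_cpow_half (by positivity) (neg_ne_zero.mpr I_ne_zero),
      cpow_def_of_ne_zero (neg_ne_zero.mpr I_ne_zero), log_neg_I, Real.sqrt_div zero_le_one]
    push_cast
    rw [Real.sqrt_one]
    congr 2
    simp
    ring
  have hsd : (Real.sqrt d : ℂ) ≠ 0 := by exact_mod_cast (Real.sqrt_pos.mpr hdr).ne'
  have hsd2 : (Real.sqrt d : ℂ) ^ 2 = d := by exact_mod_cast Real.sq_sqrt hdr.le
  have hne : (-I * (1 / d) : ℂ) ^ (1 / 2 : ℂ) ≠ 0 := by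
    rw [e4]; exact mul_ne_zero (one_div_ne_zero hsd) (Complex.exp_ne_zero _)
  have L := ((tendsto_const_nhds (x := (1 : ℂ))).div l2 hne).mul
    ((tendsto_const_nhds (x := (1 : ℂ))).div (l3.const_mul (d : ℂ)) (by simpa using hdc)) |>.mul l1
  have e5 : 1 / (-I * (1 / d) : ℂ) ^ (1 / 2 : ℂ) * (1 / (d * 1)) * 1 =
      1 / (Real.sqrt d) * cexp (Real.pi * I / 4) := by
    rw [e4, Complex.exp_neg, ← hsd2]
    have := Complex.exp_ne_zero (Real.pi * I / 4)
    field_simp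
  rw [e5] at L
  refine L.congr' ?_
  filter_upwards [self_mem_nhdsWithin] with ε hε
  rw [key ε hε]
  rfl

open Complex Filter Topology in
lemma gauss_pos (d N : ℕ) (hd : 0 < d) (hd2 : 2 ∣ d) (hN : 0 < N) (hdN : d ∣ N) :
    ∑ r : Fin N, cexp (Real.pi * I * (r : ℕ) ^ 2 / d) =
      ((N / Real.sqrt d : ℝ) : ℂ) * cexp (Real.pi * I / 4) := by
  have h1 : Tendsto (fun ε : ℝ => (Real.sqrt ε : ℂ) * jacobiTheta (1 / d + I * ε)) (𝓝[>] 0)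
      (𝓝 (∑ r : Fin N, cexp (Real.pi * I * (r : ℕ) ^ 2 / d) * ((1 / N : ℝ) : ℂ))) := by
    have : Tendsto (fun ε : ℝ => ∑ r : Fin N, cexp (Real.pi * I * (r : ℕ) ^ 2 / d) *
      ((Real.sqrt ε * HurwitzZeta.evenKernel (((r : ℕ) / N : ℝ) : UnitAddCircle) (N ^ 2 * ε) : ℝ) : ℂ)) (𝓝[>] 0)
      (𝓝 (∑ r : Fin N, cexp (Real.pi * I * (r : ℕ) ^ 2 / d) * ((1 / N : ℝ) : ℂ))) := by
      refine tendsto_finsetSum _ fun r _ => Tendsto.const_mul _ ?_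
      exact (continuous_ofReal.tendsto _).comp (kernel_lim N hN _)
    refine this.congr' ?_
    filter_upwards [self_mem_nhdsWithin] with ε hε
    rw [theta_split d N hd hd2 hN hdN ε hε, Finset.mul_sum]
    refine Finset.sum_congr rfl fun r _ => ?_
    push_cast
    ring
  have h2 := tendsto_nhds_unique h1 (theta_lim d hd hd2)
  rw [← Finset.sum_mul] at h2
  have hNc : (N : ℂ) ≠ 0 := by exact_mod_cast hN.ne'
  push_cast at h2 ⊢
  rw [mul_one_div, div_eq_iff hNc] at h2
  rw [h2]; ring

lemma coset_sum {A : Type*} [AddCommGroup A] [Fintype A] (H : AddSubgroup A) (f : A → ℂ)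
    (h1 : ∀ h ∈ H, f h = 1)
    (h2 : ∀ k, k ∉ H → ∃ h0 ∈ H, ∃ c : ℂ, c ≠ 1 ∧ ∀ h ∈ H, f (k + h + h0) = c * f (k + h)) :
    ∑ k, f k = (Nat.card H : ℂ) := by
  classical
  have hc : (Fintype.card H : ℂ) ≠ 0 := by exact_mod_cast Fintype.card_ne_zero
  rw [Nat.card_eq_fintype_card]
  apply mul_left_cancel₀ hc
  have e1 : (Fintype.card H : ℂ) * ∑ k, f k = ∑ k, ∑ h : H, f (k + h) := by
    rw [Finset.sum_comm]
    have : ∀ h : H, ∑ k, f (k + h) = ∑ k, f k := fun h =>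
      Equiv.sum_comp (Equiv.addRight (h : A)) f
    simp [this]
  have e2 : ∀ k, ∑ h : H, f (k + h) = if k ∈ H then (Fintype.card H : ℂ) else 0 := by
    intro k
    split_ifs with hk
    · rw [Finset.sum_congr rfl fun h _ => h1 _ (H.add_mem hk h.2)]
      simp
    · obtain ⟨h0, hh0, c, hc1, hc2⟩ := h2 k hk
      have : ∑ h : H, f (k + h) = c * ∑ h : H, f (k + h) := by
        conv_lhs => rw [← Equiv.sum_comp (Equiv.addRight (⟨h0, hh0⟩ : H))]
        rw [Finset.mul_sum]
        refine Finset.sum_congr rfl fun h _ => ?_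
        rw [← hc2 h h.2]
        simp [add_assoc]
      have h3 : (c - 1) * ∑ h : H, f (k + h) = 0 := by linear_combination -this
      exact (mul_eq_zero.mp h3).resolve_left (sub_ne_zero.mpr hc1)
  rw [e1, Finset.sum_congr rfl fun k _ => e2 k, ← Finset.sum_filter, Finset.sum_const,
    ← Fintype.card_subtype, nsmul_eq_mul]

lemma exists_diag {n : ℕ} (M : Matrix (Fin n) (Fin n) ℤ) (hs : M.IsSymm) :
    ∃ (P : Matrix (Fin n) (Fin n) ℤ) (d : Fin n → ℤ), P.det ≠ 0 ∧ Pᵀ * M * P = diagonal d := by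
  let MQ : Matrix (Fin n) (Fin n) ℚ := M.map (Int.cast : ℤ → ℚ)
  have hsym : LinearMap.IsSymm (Matrix.toBilin' MQ) := by
    refine ⟨fun x y => ?_⟩
    rw [RingHom.id_apply]
    rw [Matrix.toBilin'_apply', Matrix.toBilin'_apply', Matrix.dotProduct_mulVec, dotProduct_comm,
      ← Matrix.mulVec_transpose]
    congr 2
    ext i j
    simp [MQ, hs.apply]
  obtain ⟨v0, hv0⟩ := LinearMap.BilinForm.exists_orthogonal_basis hsym
  have hfr : Module.finrank ℚ (Fin n → ℚ) = n := by simp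
  let v := v0.reindex (finCongr hfr)
  have hv : ∀ i j, i ≠ j → v i ⬝ᵥ MQ *ᵥ v j = 0 := by
    intro i j hij
    have := hv0 (i := (finCongr hfr).symm i) (j := (finCongr hfr).symm j) (by simpa using hij)
    simpa [v, LinearMap.IsOrthoᵢ, Function.onFun, Matrix.toBilin'_apply'] using this
  let Q : Matrix (Fin n) (Fin n) ℚ := Matrix.of fun i j => v j i
  have hQ : Q.det ≠ 0 := by
    have : Q = (Pi.basisFun ℚ (Fin n)).toMatrix v := by
      ext i j; simp [Q, Module.Basis.toMatrix_apply]
    rw [this, ← Module.Basis.det_apply]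
    exact (Module.Basis.isUnit_det _ v).ne_zero
  obtain ⟨b, hb⟩ := IsLocalization.exist_integer_multiples_of_finite (nonZeroDivisors ℤ)
    (fun p : Fin n × Fin n => Q p.1 p.2)
  choose p hp using hb
  let P : Matrix (Fin n) (Fin n) ℤ := Matrix.of fun i j => p (i, j)
  have hPQ : P.map (Int.cast : ℤ → ℚ) = ((b : ℤ) : ℚ) • Q := by
    ext i j
    have := hp (i, j)
    simpa [P, Algebra.smul_def] using this
  have hb0 : ((b : ℤ) : ℚ) ≠ 0 := by exact_mod_cast nonZeroDivisors.coe_ne_zero b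
  refine ⟨P, fun i => (Pᵀ * M * P) i i, ?_, ?_⟩
  · intro h
    have h1 : (P.map (Int.cast : ℤ → ℚ)).det = 0 := by
      have := Int.cast_det (R := ℚ) P
      rw [h] at this
      simpa using this.symm
    rw [hPQ, det_smul] at h1
    exact (mul_ne_zero (pow_ne_zero _ hb0) hQ) h1
  · ext i j
    by_cases hij : i = j
    · subst hij; simp
    rw [diagonal_apply_ne _ hij]
    have h1 : (((Pᵀ * M * P) i j : ℤ) : ℚ) = (b : ℤ) * (b : ℤ) * (v i ⬝ᵥ MQ *ᵥ v j) := by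
      have : (((Pᵀ * M * P) i j : ℤ) : ℚ) = ((P.map (Int.cast : ℤ → ℚ))ᵀ * MQ * (P.map (Int.cast : ℤ → ℚ))) i j := by
        simp [Matrix.mul_apply, MQ]
      rw [this, hPQ, Matrix.mul_assoc, transpose_smul, Matrix.mul_smul, Matrix.smul_mul, Matrix.mul_smul,
        smul_smul, Matrix.smul_apply, smul_eq_mul]
      congr 1
    rw [hv i j hij, mul_zero] at h1
    exact_mod_cast h1

lemma signature_eq {n : ℕ} (M P : Matrix (Fin n) (Fin n) ℤ) (d : Fin n → ℤ) (hP : P.det ≠ 0)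
    (h : Pᵀ * M * P = diagonal d) : signatureZ M = ∑ i, (d i).sign := by
  let MR : Matrix (Fin n) (Fin n) ℝ := M.map (Int.cast : ℤ → ℝ)
  let PR : Matrix (Fin n) (Fin n) ℝ := P.map (Int.cast : ℤ → ℝ)
  let Q : QuadraticForm ℝ (Fin n → ℝ) := (Matrix.toBilin' MR).toQuadraticMap
  have hQ : ∀ x, Q x = realForm M x x := by
    intro x
    simp [Q, realForm, MR, Matrix.toBilin'_apply', LinearMap.BilinMap.toQuadraticMap_apply]
  have hPR : IsUnit PR.det := by
    have := Int.cast_det (R := ℝ) P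
    rw [isUnit_iff_ne_zero]
    change (P.map (Int.cast : ℤ → ℝ)).det ≠ 0
    intro h0
    have : ((P.det : ℤ) : ℝ) = 0 := by rw [Int.cast_det]; exact h0
    exact hP (by exact_mod_cast this)
  have hR : PRᵀ * MR * PR = diagonal (fun i => (d i : ℝ)) := by
    have := congrArg (fun X : Matrix (Fin n) (Fin n) ℤ => X.map (Int.castRingHom ℝ)) h
    simp only [Matrix.map_mul, Matrix.transpose_map] at this
    rw [diagonal_map (by simp)] at this
    exact this
  let e := Matrix.toLinearEquiv' PR (Matrix.invertibleOfIsUnitDet PR hPR)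
  have he : QuadraticMap.Equivalent Q (QuadraticMap.weightedSumSquares ℝ (fun i => (d i : ℝ))) := by
    symm
    refine ⟨⟨e, ?_⟩⟩
    intro x
    have hex : e x = PR *ᵥ x := rfl
    change Q (e x) = _
    rw [hQ, hex]
    have : realForm M (PR *ᵥ x) (PR *ᵥ x) = x ⬝ᵥ (PRᵀ * MR * PR) *ᵥ x := by
      rw [realForm, ← mulVec_mulVec, ← mulVec_mulVec, dotProduct_mulVec x, vecMul_transpose]
    rw [this, hR, QuadraticMap.weightedSumSquares_apply, dotProduct]
    refine Finset.sum_congr rfl fun i _ => ?_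
    rw [mulVec_diagonal, smul_eq_mul]; ring
  have hp : posIndex M = {i | 0 < (d i : ℝ)}.ncard := by
    rw [← QuadraticForm.sigPos_of_equiv_weightedSumSquares he, posIndex]
    rw [← (sigPos_isGreatest Q).csSup_eq]
    congr! 5 with k H
    simp [QuadraticMap.PosDef, hQ]
  have hn : negIndex M = {i | (d i : ℝ) < 0}.ncard := by
    rw [← QuadraticForm.sigNeg_of_equiv_weightedSumSquares he, negIndex]
    rw [← (sigNeg_isGreatest Q).csSup_eq]
    congr! 5 with k H
    simp [QuadraticMap.PosDef, hQ]
  classical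
  rw [signatureZ, hp, hn, Set.ncard_eq_toFinset_card', Set.ncard_eq_toFinset_card']
  have : ∀ i, (d i).sign = (if 0 < d i then 1 else 0) - (if d i < 0 then 1 else 0) := by
    intro i
    rcases lt_trichotomy (d i) 0 with h | h | h
    · rw [Int.sign_eq_neg_one_of_neg h]; simp [h, h.le, h.not_gt]
    · simp [h]
    · rw [Int.sign_eq_one_of_pos h]; simp [h, h.le, h.not_gt]
  simp [this, Finset.sum_sub_distrib]

open Complex in
lemma exp_shift (d N x m : ℤ) (hd : d ≠ 0) (hd2 : 2 ∣ d) (hdN : d ∣ N) :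
    cexp (Real.pi * I * ((x + N * m : ℤ) : ℂ) ^ 2 / d) = cexp (Real.pi * I * (x : ℂ) ^ 2 / d) := by
  obtain ⟨a, rfl⟩ := hd2
  obtain ⟨b, rfl⟩ := hdN
  have ha : (a : ℂ) ≠ 0 := by rintro h; simp at h; simp [h] at hd
  rw [Complex.exp_eq_exp_iff_exists_int]
  refine ⟨x * b * m + a * b ^ 2 * m ^ 2, ?_⟩
  push_cast
  field_simp
  ring

open Complex in
lemma gauss_int (d : ℤ) (N : ℕ) [NeZero N] (hd : d ≠ 0) (hd2 : 2 ∣ d) (hdN : d ∣ N) :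
    ∃ c : ℝ, 0 < c ∧ ∑ r : ZMod N, cexp (Real.pi * I * ((r.val : ℤ) : ℂ) ^ 2 / d) =
      c * cexp (Real.pi * I * (d.sign : ℤ) / 4) := by
  have hN : 0 < N := Nat.pos_of_ne_zero (NeZero.ne N)
  have hpos : ∀ e : ℕ, 0 < e → 2 ∣ e → e ∣ N → ∑ r : ZMod N, cexp (Real.pi * I * ((r.val : ℤ) : ℂ) ^ 2 / e) =
      ((N / Real.sqrt e : ℝ) : ℂ) * cexp (Real.pi * I / 4) := by
    intro e h1 h2 h3
    rw [← gauss_pos e N h1 h2 hN h3]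
    cases N with
    | zero => omega
    | succ k => rfl
  rcases lt_or_gt_of_ne hd with h | h
  · obtain ⟨e, he⟩ : ∃ e : ℕ, d = -e := ⟨d.natAbs, by omega⟩
    subst he
    have he : 0 < e := by omega
    have her : (0 : ℝ) < e := by exact_mod_cast he
    refine ⟨N / Real.sqrt e, by positivity, ?_⟩
    have := congrArg (starRingEnd ℂ) (hpos e he (by omega) (by
      rw [neg_dvd] at hdN; exact_mod_cast hdN))
    rw [map_sum] at this
    simp only [map_mul, ← Complex.exp_conj, map_div₀, map_pow, conj_I, conj_ofReal, map_natCast,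
      map_intCast, map_ofNat] at this
    rw [Int.sign_eq_neg_one_of_neg h]
    convert this using 3
    · push_cast; rw [div_neg]; ring_nf
    · push_cast; ring_nf
  · obtain ⟨e, he⟩ : ∃ e : ℕ, d = e := ⟨d.natAbs, by omega⟩
    subst he
    have he : 0 < e := by omega
    have her : (0 : ℝ) < e := by exact_mod_cast he
    refine ⟨N / Real.sqrt e, by positivity, ?_⟩
    rw [Int.sign_eq_one_of_pos h]
    have := hpos e he (by omega) (by exact_mod_cast hdN)
    simpa using this

open Complex in
lemma gauss_lattice {n : ℕ} (M P : Matrix (Fin n) (Fin n) ℤ) (d : Fin n → ℤ) (N : ℕ) [NeZero N]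
    (hs : M.IsSymm) (hu : IsUnit M.det) (heven : ∀ x : Fin n → ℤ, 2 ∣ intForm M x x)
    (hP : P.det ≠ 0) (h : Pᵀ * M * P = diagonal d) (hd : ∀ i, d i ≠ 0) (hd2 : ∀ i, 2 ∣ d i)
    (hdN : ∀ i, d i ∣ N) :
    ∃ c : ℕ, ∑ k : Fin n → ZMod N, ∏ i, cexp (Real.pi * I * (((k i).val : ℤ) : ℂ) ^ 2 / d i) = c := by
  -- the function on ℤ^n
  let F : (Fin n → ℤ) → ℂ := fun x => ∏ i, cexp (Real.pi * I * (x i : ℂ) ^ 2 / d i)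
  let π : (Fin n → ℤ) →+ (Fin n → ZMod N) := 
    { toFun := fun x i => (x i : ZMod N), map_zero' := by ext; simp, map_add' := by intros; ext; simp }
  have hπ : ∀ x i, π x i = (x i : ZMod N) := fun _ _ => rfl
  let f : (Fin n → ZMod N) → ℂ := fun k => F fun i => ((k i).val : ℤ)
  have hf : ∀ x, f (π x) = F x := by
    intro x
    refine Finset.prod_congr rfl fun i _ => ?_
    obtain ⟨m, hm⟩ : ∃ m : ℤ, x i = ((x i : ZMod N).val : ℤ) + N * m := by
      refine ⟨x i / N, ?_⟩
      rw [ZMod.val_intCast, Int.emod_add_mul_ediv]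
    beta_reduce
    rw [hπ]
    conv_rhs => rw [hm]
    exact (exp_shift (d i) N _ m (hd i) (hd2 i) (hdN i)).symm
  let z : (Fin n → ℤ) →+ (Fin n → ℤ) := (Pᵀ * M).mulVecLin.toAddMonoidHom
  have hz : ∀ y, z y = (Pᵀ * M) *ᵥ y := fun _ => rfl
  let H : AddSubgroup (Fin n → ZMod N) := (π.comp z).range
  -- the real inverse
  let PR : Matrix (Fin n) (Fin n) ℂ := P.map (Int.cast : ℤ → ℂ)
  have hPR : IsUnit PR.det := by
    rw [isUnit_iff_ne_zero]
    intro h0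
    have : ((P.det : ℤ) : ℂ) = 0 := by rw [Int.cast_det]; exact h0
    exact hP (by exact_mod_cast this)
  let cc : (Fin n → ℤ) → (Fin n → ℂ) := fun y i => (y i : ℂ)
  let v : (Fin n → ℤ) → (Fin n → ℂ) := fun y => PR⁻¹ *ᵥ cc y
  have hcm : ∀ (A : Matrix (Fin n) (Fin n) ℤ) y, cc (A *ᵥ y) = A.map (Int.cast : ℤ → ℂ) *ᵥ cc y := by
    intro A y; ext i; simp [cc, mulVec, dotProduct]
  have hcd : ∀ x y, ((x ⬝ᵥ y : ℤ) : ℂ) = cc x ⬝ᵥ cc y := by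
    intro x y; simp [cc, dotProduct]
  have hv : ∀ y, PR *ᵥ v y = cc y := by
    intro y; simp [v, mulVec_mulVec, Matrix.mul_nonsing_inv _ hPR]
  have hR : PRᵀ * M.map (Int.cast : ℤ → ℂ) * PR = diagonal (fun i => (d i : ℂ)) := by
    have := congrArg (fun X : Matrix (Fin n) (Fin n) ℤ => X.map (Int.castRingHom ℂ)) h
    simp only [Matrix.map_mul, Matrix.transpose_map] at this
    rw [diagonal_map (by simp)] at this
    exact this
  have hPM : (Pᵀ * M).map (Int.cast : ℤ → ℂ) = PRᵀ * M.map (Int.cast : ℤ → ℂ) := by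
    have := Matrix.map_mul (L := Pᵀ) (M := M) (f := Int.castRingHom ℂ)
    rw [Matrix.transpose_map] at this
    exact this
  have hzv : ∀ y i, ((z y i : ℤ) : ℂ) = d i * v y i := by
    intro y i
    have : cc (z y) = diagonal (fun i => (d i : ℂ)) *ᵥ v y := by
      rw [hz, hcm, ← hR, ← mulVec_mulVec, hv, hPM]
    have := congrFun this i
    rwa [mulVec_diagonal] at this
  have hzvd : ∀ y' y, cc (z y') ⬝ᵥ v y = ((M *ᵥ y') ⬝ᵥ y : ℤ) := by
    intro y' y
    rw [hcd, ← hv y, hz, ← mulVec_mulVec, hcm]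
    rw [show Pᵀ.map (Int.cast : ℤ → ℂ) = PRᵀ from rfl, mulVec_transpose, ← dotProduct_mulVec]
  have hdc : ∀ i, (d i : ℂ) ≠ 0 := fun i => by exact_mod_cast hd i
  have hFz : ∀ y, F (z y) = 1 := by
    intro y
    simp only [F]
    rw [← Complex.exp_sum]
    obtain ⟨m, hm⟩ := heven y
    rw [Complex.exp_eq_one_iff]
    refine ⟨m, ?_⟩
    have e1 : ∑ i, (Real.pi * I * (z y i : ℂ) ^ 2 / d i) = Real.pi * I * (cc (z y) ⬝ᵥ v y) := by
      rw [dotProduct, Finset.mul_sum]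
      refine Finset.sum_congr rfl fun i _ => ?_
      have := hdc i
      simp only [cc]
      rw [hzv]; field_simp
    rw [e1, hzvd, dotProduct_comm]
    rw [intForm] at hm
    rw [hm]; push_cast; ring
  have hFadd : ∀ x y, F (x + z y) = cexp (2 * Real.pi * I * (cc x ⬝ᵥ v y)) * F x := by
    intro x y
    have : F (x + z y) = cexp (2 * Real.pi * I * (cc x ⬝ᵥ v y)) * F x * F (z y) := by
      simp only [F]
      rw [← Complex.exp_sum, ← Complex.exp_sum, ← Complex.exp_sum, ← Complex.exp_add,
        ← Complex.exp_add, dotProduct, Finset.mul_sum, ← Finset.sum_add_distrib,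
        ← Finset.sum_add_distrib]
      congr 1
      refine Finset.sum_congr rfl fun i _ => ?_
      have := hdc i
      simp only [cc, Pi.add_apply]
      push_cast
      rw [hzv]
      field_simp
      ring
    rw [this, hFz, mul_one]
  refine ⟨Nat.card H, ?_⟩
  refine coset_sum H f ?_ ?_
  · rintro _ ⟨y, rfl⟩
    rw [AddMonoidHom.comp_apply, hf, hFz]
  · intro k hk
    let x : Fin n → ℤ := fun i => ((k i).val : ℤ)
    have hx : π x = k := by ext i; simp [hπ, x]
    have hex : ∃ j, ∀ m : ℤ, cc x ⬝ᵥ v (Pi.single j 1) ≠ m := by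
      by_contra! hcon
      choose w hw using hcon
      apply hk
      have hxw : x = Pᵀ *ᵥ w := by
        have h1 : cc w = cc x ᵥ* PR⁻¹ := by
          ext j
          change (w j : ℂ) = _
          rw [← hw j]
          simp only [v]
          rw [dotProduct_mulVec]
          have : cc (Pi.single j 1) = Pi.single j 1 := by
            ext i; by_cases hij : i = j
            · subst hij; simp [cc]
            · simp [cc, hij]
          rw [this]; simp
        have h2 : cc (Pᵀ *ᵥ w) = cc x := by
          rw [hcm, h1, show Pᵀ.map (Int.cast : ℤ → ℂ) = PRᵀ from rfl, mulVec_transpose, vecMul_vecMul,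
            Matrix.nonsing_inv_mul _ hPR, vecMul_one]
        ext i
        have := congrFun h2 i
        simp only [cc] at this
        exact_mod_cast this.symm
      refine ⟨M⁻¹ *ᵥ w, ?_⟩
      rw [AddMonoidHom.comp_apply, hz, mulVec_mulVec, Matrix.mul_assoc, Matrix.mul_nonsing_inv _ hu,
        Matrix.mul_one, ← hxw, hx]
    obtain ⟨j, hj⟩ := hex
    refine ⟨π (z (Pi.single j 1)), ⟨_, rfl⟩, cexp (2 * Real.pi * I * (cc x ⬝ᵥ v (Pi.single j 1))), ?_, ?_⟩
    · rw [Ne, Complex.exp_eq_one_iff]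
      rintro ⟨m, hm⟩
      refine hj m ?_
      have h2 := Complex.two_pi_I_ne_zero
      apply mul_left_cancel₀ h2
      rw [hm]; ring
    · rintro _ ⟨y, rfl⟩
      rw [AddMonoidHom.comp_apply, ← hx, ← map_add, ← map_add, hf, hf, hFadd]
      congr 1
      have : cc (x + z y) = cc x + cc (z y) := by ext i; simp [cc]
      rw [this, add_dotProduct, hzvd, Complex.exp_eq_exp_iff_exists_int]
      exact ⟨_, by rw [mul_add]; rw [mul_comm (2 * Real.pi * I) ((_ : ℤ) : ℂ)]⟩

open Complex in
lemma even_unimodular_aux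
    {n : ℕ} (M : Matrix (Fin n) (Fin n) ℤ)
    (hs : M.IsSymm)
    (hu : M.det = 1 ∨ M.det = -1)
    (heven : ∀ x : Fin n → ℤ, 2 ∣ intForm M x x) :
    (8 : ℤ) ∣ signatureZ M := by
  have hu' : IsUnit M.det := Int.isUnit_iff.mpr hu
  obtain ⟨P, d, hP, h⟩ := exists_diag M hs
  have hprod : P.det * M.det * P.det = ∏ i, d i := by
    rw [← det_diagonal, ← h, det_mul, det_mul, det_transpose]
  have hd : ∀ i, d i ≠ 0 := by
    intro i
    have : ∏ i, d i ≠ 0 := by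
      rw [← hprod]; exact mul_ne_zero (mul_ne_zero hP hu'.ne_zero) hP
    exact Finset.prod_ne_zero_iff.mp this i (Finset.mem_univ i)
  have hd2 : ∀ i, 2 ∣ d i := by
    intro i
    have : d i = intForm M (P *ᵥ Pi.single i 1) (P *ᵥ Pi.single i 1) := by
      have h1 := congrFun (congrFun h i) i
      rw [diagonal_apply_eq] at h1
      rw [← h1, intForm, mulVec_mulVec, ← vecMul_transpose, ← dotProduct_mulVec, mulVec_mulVec,
        ← Matrix.mul_assoc]
      simp
    rw [this]; exact heven _
  let N : ℕ := (∏ i, d i).natAbs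
  have : NeZero N := ⟨by simpa [N, Finset.prod_eq_zero_iff] using hd⟩
  have hdN : ∀ i, d i ∣ (N : ℤ) := fun i =>
    Int.dvd_natAbs.mpr (Finset.dvd_prod_of_mem d (Finset.mem_univ i))
  obtain ⟨c, hc⟩ := gauss_lattice M P d N hs hu' heven hP h hd hd2 hdN
  choose g hg hgs using fun i => gauss_int (d i) N (hd i) (hd2 i) (hdN i)
  have e1 : ∏ i, ∑ r : ZMod N, cexp (Real.pi * I * ((r.val : ℤ) : ℂ) ^ 2 / d i) = c := by
    rw [← hc, Finset.prod_univ_sum, Fintype.piFinset_univ]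
  rw [Finset.prod_congr rfl fun i _ => hgs i, Finset.prod_mul_distrib, ← Complex.exp_sum] at e1
  have e2 : ∑ i, (Real.pi * I * ((d i).sign : ℤ) / 4 : ℂ) = ((Real.pi * signatureZ M / 4 : ℝ) : ℂ) * I := by
    rw [signature_eq M P d hP h]
    push_cast
    rw [Finset.mul_sum, Finset.sum_div, Finset.sum_mul]
    refine Finset.sum_congr rfl fun i _ => ?_
    ring
  rw [e2] at e1
  have hG : 0 < ∏ i, g i := Finset.prod_pos fun i _ => hg i
  have e3 : ((∏ i, g i : ℝ) : ℂ) * cexp (((Real.pi * signatureZ M / 4 : ℝ) : ℂ) * I) = c := by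
    rw [← e1]; push_cast; rfl
  have e4 := congrArg norm e3
  rw [norm_mul, norm_exp_ofReal_mul_I, mul_one, norm_real, Real.norm_of_nonneg hG.le,
    Complex.norm_natCast] at e4
  rw [e4] at e3
  have hc0 : (c : ℂ) ≠ 0 := by
    have : (c : ℝ) ≠ 0 := by rw [← e4]; exact hG.ne'
    exact_mod_cast this
  have e5 : cexp (((Real.pi * signatureZ M / 4 : ℝ) : ℂ) * I) = 1 := by
    apply mul_left_cancel₀ hc0
    rw [mul_one]; exact_mod_cast e3
  rw [Complex.exp_eq_one_iff] at e5
  obtain ⟨m, hm⟩ := e5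
  refine ⟨m, ?_⟩
  have hpi : (Real.pi : ℂ) ≠ 0 := by exact_mod_cast Real.pi_ne_zero
  have e6 : (signatureZ M : ℂ) = 8 * m := by
    apply mul_left_cancel₀ hpi
    apply mul_right_cancel₀ I_ne_zero
    push_cast at hm
    linear_combination 4 * hm
  exact_mod_cast e6

theorem even_unimodular_signature_div_eight
    {n : ℕ} (M : Matrix (Fin n) (Fin n) ℤ)
    (hs : M.IsSymm)
    (hu : M.det = 1 ∨ M.det = -1)
    (heven : ∀ x : Fin n → ℤ, 2 ∣ intForm M x x) :
    (8 : ℤ) ∣ signatureZ M := by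
  exact even_unimodular_aux M hs hu heven
end
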